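/- There exist constants c > 0 and C > 0 depending only on n and W such that for all sufficiently large R the following holds. Let u : ℝⁿ → [-1,1] be a C² solution of Δu = W'(u) in ℝⁿ such that (a) the ball B_R(-R e_n) is contained in {u<0} and 0 ∈ {u=0} (so B_R(-R e_n) is tangent to {u=0} at the origin), and (b) there is a point x₀ ∈ B_{R/4}(-R e_n) with u(x₀) ≤ -1+c. Then in the unit ball B₁(0): (1) {u=0} ∩ B₁(0) is the graph in the e_n direction of a C² function with second derivatives bounded by C/R; (2) |u(x) - g(x_n)| ≤ C/R for all x ∈ B₁(0). -/

import Mathlib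

open MeasureTheory Metric Set Filter RealInnerProductSpace

noncomputable section

/-- The Laplacian of `u : ℝⁿ → ℝ`: the sum of the pure second partial derivatives. -/
def lap (n : ℕ) (u : EuclideanSpace ℝ (Fin n) → ℝ) (x : EuclideanSpace ℝ (Fin n)) : ℝ :=
  ∑ i : Fin n,
    fderiv ℝ (fun y => fderiv ℝ u y (EuclideanSpace.single i 1)) x (EuclideanSpace.single i 1)

/-- `W` is a double-well potential. -/
def DoubleWell (W : ℝ → ℝ) : Prop :=
  ContDiffOn ℝ 2 W (Set.Icc (-1) 1) ∧ W (-1) = 0 ∧ W 1 = 0 ∧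
  (∀ s ∈ Set.Ioo (-1:ℝ) 1, 0 < W s) ∧ deriv W (-1) = 0 ∧ deriv W 1 = 0 ∧
  0 < deriv (deriv W) (-1) ∧ 0 < deriv (deriv W) 1

/-- `g` is the one-dimensional solution of `g'' = W'(g)`, `g' > 0`, `g(0)=0`,
`g(±∞) = ±1`. -/
def IsOneDSolution (W g : ℝ → ℝ) : Prop :=
  ContDiff ℝ 2 g ∧ (∀ t, g t ∈ Set.Ioo (-1:ℝ) 1) ∧
  (∀ t, deriv (deriv g) t = deriv W (g t)) ∧ (∀ t, 0 < deriv g t) ∧ g 0 = 0 ∧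
  Tendsto g atTop (nhds 1) ∧ Tendsto g atBot (nhds (-1))

/-! ### Calculus of the Laplacian -/

section Laplacian

variable {n : ℕ} {u v : EuclideanSpace ℝ (Fin n) → ℝ}

lemma hasDerivAt_line {E : Type*} [NormedAddCommGroup E] [NormedSpace ℝ E] {u : E → ℝ}
    (hu : Differentiable ℝ u) (x v : E) (t : ℝ) :
    HasDerivAt (fun t : ℝ => u (x + t • v)) (fderiv ℝ u (x + t • v) v) t := by
  have h1 : HasDerivAt (fun t : ℝ => x + t • v) v t := by
    simpa using ((hasDerivAt_id t).smul_const v).const_add x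
  exact (hu _).hasFDerivAt.comp_hasDerivAt t h1

lemma differentiable_fderiv_apply (hu : ContDiff ℝ 2 u) (v : EuclideanSpace ℝ (Fin n)) :
    Differentiable ℝ (fun y => fderiv ℝ u y v) :=
  ((hu.fderiv_right (m := 1) (by norm_num)).clm_apply contDiff_const).differentiable (by norm_num)

lemma contDiff_fderiv_apply (hu : ContDiff ℝ 2 u) (v : EuclideanSpace ℝ (Fin n)) :
    ContDiff ℝ 1 (fun y => fderiv ℝ u y v) :=
  (hu.fderiv_right (m := 1) (by norm_num)).clm_apply contDiff_const

lemma differentiable_fderiv {E : Type*} [NormedAddCommGroup E] [NormedSpace ℝ E] {u : E → ℝ}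
    (hu : ContDiff ℝ 2 u) : Differentiable ℝ (fderiv ℝ u) :=
  (hu.fderiv_right (m := 1) (by norm_num)).differentiable (by norm_num)

lemma fderiv_fderiv_apply (hu : ContDiff ℝ 2 u) (x v w : EuclideanSpace ℝ (Fin n)) :
    fderiv ℝ (fun y => fderiv ℝ u y v) x w = fderiv ℝ (fderiv ℝ u) x w v := by
  rw [fderiv_clm_apply (differentiable_fderiv hu x) (differentiableAt_const v)]
  simp

lemma hasDerivAt_line_fderiv (hu : ContDiff ℝ 2 u) (x v : EuclideanSpace ℝ (Fin n)) (t : ℝ) :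
    HasDerivAt (fun t : ℝ => fderiv ℝ u (x + t • v) v)
      (fderiv ℝ (fun y => fderiv ℝ u y v) (x + t • v) v) t :=
  hasDerivAt_line (differentiable_fderiv_apply hu v) x v t

/-- The Laplacian of a `C²` function can be computed along coordinate lines. -/
lemma lap_eq_of_line (hu : ContDiff ℝ 2 u) (x : EuclideanSpace ℝ (Fin n))
    (φ : Fin n → ℝ → ℝ) (a : Fin n → ℝ)
    (h1 : ∀ i t, HasDerivAt (fun t : ℝ => u (x + t • EuclideanSpace.single i (1:ℝ))) (φ i t) t)
    (h2 : ∀ i, HasDerivAt (φ i) (a i) 0) : lap n u x = ∑ i, a i := by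
  unfold lap
  refine Finset.sum_congr rfl fun i _ => ?_
  have h3 : φ i = fun t => fderiv ℝ u (x + t • EuclideanSpace.single i (1:ℝ))
      (EuclideanSpace.single i (1:ℝ)) := by
    funext t
    exact (h1 i t).unique (hasDerivAt_line (hu.differentiable (by norm_num)) x _ t)
  have h4 := hasDerivAt_line_fderiv hu x (EuclideanSpace.single i (1:ℝ)) 0
  rw [← h3] at h4
  simpa using h4.unique (h2 i)

lemma lap_add (hu : ContDiff ℝ 2 u) (hv : ContDiff ℝ 2 v) (x : EuclideanSpace ℝ (Fin n)) :
    lap n (fun y => u y + v y) x = lap n u x + lap n v x := by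
  rw [lap_eq_of_line (hu.add hv) x _ _
    (fun i t => (hasDerivAt_line (hu.differentiable (by norm_num)) x _ t).add
      (hasDerivAt_line (hv.differentiable (by norm_num)) x _ t))
    (fun i => (hasDerivAt_line_fderiv hu x _ 0).add (hasDerivAt_line_fderiv hv x _ 0))]
  simp [lap, Finset.sum_add_distrib]

lemma lap_const_mul (hu : ContDiff ℝ 2 u) (c : ℝ) (x : EuclideanSpace ℝ (Fin n)) :
    lap n (fun y => c * u y) x = c * lap n u x := by
  rw [lap_eq_of_line (contDiff_const.mul hu) x _ _
    (fun i t => (hasDerivAt_line (hu.differentiable (by norm_num)) x _ t).const_mul c)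
    (fun i => (hasDerivAt_line_fderiv hu x _ 0).const_mul c)]
  simp [lap, Finset.mul_sum]

lemma lap_sub (hu : ContDiff ℝ 2 u) (hv : ContDiff ℝ 2 v) (x : EuclideanSpace ℝ (Fin n)) :
    lap n (fun y => u y - v y) x = lap n u x - lap n v x := by
  rw [lap_eq_of_line (hu.sub hv) x _ _
    (fun i t => (hasDerivAt_line (hu.differentiable (by norm_num)) x _ t).sub
      (hasDerivAt_line (hv.differentiable (by norm_num)) x _ t))
    (fun i => (hasDerivAt_line_fderiv hu x _ 0).sub (hasDerivAt_line_fderiv hv x _ 0))]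
  simp [lap, Finset.sum_sub_distrib]

lemma lap_const (c : ℝ) (x : EuclideanSpace ℝ (Fin n)) : lap n (fun _ => c) x = 0 := by
  simp [lap]

lemma lap_neg (hu : ContDiff ℝ 2 u) (x : EuclideanSpace ℝ (Fin n)) :
    lap n (fun y => - u y) x = - lap n u x := by
  simpa using lap_const_mul hu (-1) x

lemma lap_comp_add (hu : ContDiff ℝ 2 u) (x a : EuclideanSpace ℝ (Fin n)) :
    lap n (fun y => u (y + a)) x = lap n u (x + a) := by
  have hc : ContDiff ℝ 2 fun y => u (y + a) := hu.comp (contDiff_id.add contDiff_const)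
  have key : ∀ (i : Fin n) (t : ℝ), x + t • EuclideanSpace.single i (1:ℝ) + a
      = (x + a) + t • EuclideanSpace.single i (1:ℝ) := fun i t => by abel
  rw [lap_eq_of_line hc x
    (fun i t => fderiv ℝ u ((x + a) + t • EuclideanSpace.single i (1:ℝ))
      (EuclideanSpace.single i (1:ℝ)))
    (fun i => fderiv ℝ (fun y => fderiv ℝ u y (EuclideanSpace.single i (1:ℝ)))
      ((x + a) + (0:ℝ) • EuclideanSpace.single i (1:ℝ)) (EuclideanSpace.single i (1:ℝ)))
    (fun i t => by
      simp only [key]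
      exact hasDerivAt_line (hu.differentiable (by norm_num)) (x + a) _ t)
    (fun i => hasDerivAt_line_fderiv hu (x + a) _ 0)]
  simp [lap]

/-- The second derivative of a function of one variable at a local maximum is nonpositive. -/
lemma second_deriv_nonpos_of_isLocalMax {f f' : ℝ → ℝ} {a x : ℝ}
    (h1 : ∀ t, HasDerivAt f (f' t) t) (h2 : HasDerivAt f' a x) (hm : IsLocalMax f x) : a ≤ 0 := by
  by_contra! ha
  have hf' : deriv f = f' := funext fun t => (h1 t).deriv
  have h0 : deriv f x = 0 := hm.deriv_eq_zero
  have hmin : IsLocalMin f x :=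
    isLocalMin_of_deriv_deriv_pos (by rw [hf', h2.deriv]; exact ha) h0 (h1 x).continuousAt
  have hc : f =ᶠ[nhds x] fun _ => f x := by
    filter_upwards [hm, hmin] with y hy1 hy2 using le_antisymm hy1 hy2
  have hd : deriv f =ᶠ[nhds x] fun _ => 0 := by
    have := hc.deriv
    simpa using this
  have : deriv (deriv f) x = 0 := by rw [hd.deriv_eq]; simp
  rw [hf', h2.deriv] at this
  exact ha.ne' this

lemma lap_nonpos_of_isLocalMax (hu : ContDiff ℝ 2 u) {x : EuclideanSpace ℝ (Fin n)}
    (hm : IsLocalMax u x) : lap n u x ≤ 0 := by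
  unfold lap
  refine Finset.sum_nonpos fun i _ => ?_
  have h2 := hasDerivAt_line_fderiv hu x (EuclideanSpace.single i (1:ℝ)) 0
  have hm' : IsLocalMax (fun t : ℝ => u (x + t • EuclideanSpace.single i (1:ℝ))) 0 := by
    have hc : ContinuousAt (fun t : ℝ => x + t • EuclideanSpace.single i (1:ℝ)) 0 := by fun_prop
    have h3 : Tendsto (fun t : ℝ => x + t • EuclideanSpace.single i (1:ℝ)) (nhds 0) (nhds x) := by
      simpa [ContinuousAt] using hc
    have := h3.eventually hm
    simpa [IsLocalMax, IsMaxFilter] using this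
  have := second_deriv_nonpos_of_isLocalMax
    (fun t => hasDerivAt_line (hu.differentiable (by norm_num)) x _ t) h2 hm'
  simpa using this

/-- A maximum principle on compact sets. -/
lemma nonpos_of_lap_pos {K : Set (EuclideanSpace ℝ (Fin n))} (hK : IsCompact K)
    (hu : ContDiff ℝ 2 u)
    (h : ∀ x ∈ K, u x ≤ 0 ∨ (K ∈ nhds x ∧ 0 < lap n u x)) : ∀ x ∈ K, u x ≤ 0 := by
  intro x hx
  obtain ⟨y, hy, hmax⟩ := hK.exists_isMaxOn ⟨x, hx⟩ hu.continuous.continuousOn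
  rcases h y hy with h1 | ⟨h1, h2⟩
  · exact (hmax hx).trans h1
  · have : IsLocalMax u y := by
      filter_upwards [h1] with z hz using hmax hz
    linarith [lap_nonpos_of_isLocalMax hu this]

end Laplacian

/-! ### Interior gradient estimate -/

section Gradient

variable {n : ℕ} {u v : EuclideanSpace ℝ (Fin n) → ℝ}

lemma norm_add_smul_single_sq (x : EuclideanSpace ℝ (Fin n)) (j : Fin n) (t : ℝ) :
    ‖x + t • EuclideanSpace.single j (1:ℝ)‖ ^ 2 = ‖x‖ ^ 2 + 2 * t * x j + t ^ 2 := by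
  rw [norm_add_sq_real, inner_smul_right, EuclideanSpace.inner_single_right, norm_smul]
  simp
  ring

lemma add_smul_single_apply (x : EuclideanSpace ℝ (Fin n)) (i j : Fin n) (t : ℝ) :
    (x + t • EuclideanSpace.single j (1:ℝ)) i = x i + t * (if i = j then 1 else 0) := by
  simp

lemma abs_coord_le_norm (x : EuclideanSpace ℝ (Fin n)) (i : Fin n) : |x i| ≤ ‖x‖ := by
  simpa using PiLp.norm_apply_le x i

/-- Reflection in the `i`-th coordinate. -/
def reflectCoord (i : Fin n) (y : EuclideanSpace ℝ (Fin n)) : EuclideanSpace ℝ (Fin n) :=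
  y + (-2 * y i) • EuclideanSpace.single i (1:ℝ)

lemma contDiff_reflectCoord (i : Fin n) : ContDiff ℝ 2 (reflectCoord i) := by
  unfold reflectCoord
  fun_prop

lemma norm_reflectCoord (i : Fin n) (y : EuclideanSpace ℝ (Fin n)) :
    ‖reflectCoord i y‖ = ‖y‖ := by
  have : ‖reflectCoord i y‖ ^ 2 = ‖y‖ ^ 2 := by
    rw [reflectCoord, norm_add_smul_single_sq]; ring
  exact (sq_eq_sq₀ (norm_nonneg _) (norm_nonneg _)).1 this

lemma reflectCoord_add_smul_single (i j : Fin n) (y : EuclideanSpace ℝ (Fin n)) (t : ℝ) :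
    reflectCoord i (y + t • EuclideanSpace.single j (1:ℝ)) =
      reflectCoord i y + t • ((if i = j then (-1:ℝ) else 1) • EuclideanSpace.single j (1:ℝ)) := by
  unfold reflectCoord
  rw [add_smul_single_apply]
  split_ifs with h
  · subst h
    module
  · module

lemma lap_comp_reflectCoord (hu : ContDiff ℝ 2 u) (i : Fin n) (x : EuclideanSpace ℝ (Fin n)) :
    lap n (fun y => u (reflectCoord i y)) x = lap n u (reflectCoord i x) := by
  have hd : Differentiable ℝ u := hu.differentiable (by norm_num)
  rw [lap_eq_of_line (u := fun y => u (reflectCoord i y)) (hu.comp (contDiff_reflectCoord i)) x _ _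
    (fun j t => by
      simp only [reflectCoord_add_smul_single]
      exact hasDerivAt_line hd _ _ t)
    (fun j => hasDerivAt_line_fderiv hu _ _ 0)]
  unfold lap
  refine Finset.sum_congr rfl fun j _ => ?_
  have h : ∀ c : ℝ, (fun y => fderiv ℝ u y (c • EuclideanSpace.single j (1:ℝ))) =
      fun y => c * fderiv ℝ u y (EuclideanSpace.single j (1:ℝ)) := by
    intro c; funext y; simp
  rw [h, zero_smul, add_zero, fderiv_const_mul (differentiable_fderiv_apply hu _ _)]
  split_ifs <;> simp

/-- The quadratic barrier used in the interior gradient estimate. -/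
lemma lap_quadratic (i : Fin n) (a b c : ℝ) (x : EuclideanSpace ℝ (Fin n)) :
    lap n (fun y => a * ‖y‖ ^ 2 + b * y i + c * (y i) ^ 2) x = 2 * a * n + 2 * c := by
  have hc : ContDiff ℝ 2 fun y : EuclideanSpace ℝ (Fin n) =>
      a * ‖y‖ ^ 2 + b * y i + c * (y i) ^ 2 := by
    have := contDiff_norm_sq ℝ (E := EuclideanSpace ℝ (Fin n)) (n := 2)
    fun_prop
  rw [lap_eq_of_line hc x
    (fun j t => a * (2 * x j + 2 * t) + b * (if i = j then 1 else 0) +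
      c * (2 * (x i + t * (if i = j then 1 else 0)) * (if i = j then 1 else 0)))
    (fun j => 2 * a + c * (2 * (if i = j then 1 else 0)))]
  · simp [Finset.sum_add_distrib]
    ring
  · intro j t
    simp only [norm_add_smul_single_sq, add_smul_single_apply]
    generalize (if i = j then (1:ℝ) else 0) = δ
    have h1 : HasDerivAt (fun t : ℝ => a * (‖x‖ ^ 2 + 2 * t * x j + t ^ 2) + b * (x i + t * δ)
        + c * (x i + t * δ) ^ 2) _ t :=
      ((((((hasDerivAt_id t).const_mul 2).mul_const (x j)).const_add (‖x‖ ^ 2)).add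
        ((hasDerivAt_id t).pow 2)).const_mul a).add
        ((((hasDerivAt_id t).mul_const δ).const_add (x i)).const_mul b) |>.add
        (((((hasDerivAt_id t).mul_const δ).const_add (x i)).pow 2).const_mul c)
    convert h1 using 1
    simp
  · intro j
    split_ifs with h
    · have h1 : HasDerivAt (fun t : ℝ => a * (2 * x j + 2 * t) + b * 1 +
        c * (2 * (x i + t * 1) * 1)) _ 0 :=
        (((((hasDerivAt_id (0:ℝ)).const_mul 2).const_add (2 * x j)).const_mul a).add_const
          (b * 1)).add
        ((((((hasDerivAt_id (0:ℝ)).mul_const 1).const_add (x i)).const_mul 2).mul_const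
          1).const_mul c)
      convert h1 using 1
      simp; ring
    · have h1 : HasDerivAt (fun t : ℝ => a * (2 * x j + 2 * t)) _ 0 :=
        ((((hasDerivAt_id (0:ℝ)).const_mul 2).const_add (2 * x j)).const_mul a)
      simp only [mul_zero, add_zero]
      convert h1 using 1
      simp; ring

lemma partial_deriv_le_of_bounds (hu : ContDiff ℝ 2 u) (i : Fin n) {M N : ℝ}
    {x₀ : EuclideanSpace ℝ (Fin n)} (hM : ∀ x ∈ closedBall x₀ 2, |u x| ≤ M)
    (hN : ∀ x ∈ closedBall x₀ 2, |lap n u x| < N) :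
    fderiv ℝ u x₀ (EuclideanSpace.single i 1) ≤ n * M + N / 2 := by
  have hM0 : 0 ≤ M := (abs_nonneg _).trans (hM x₀ (by simp))
  have hN0 : 0 < N := (abs_nonneg _).trans_lt (hN x₀ (by simp))
  have hn1 : (1:ℝ) ≤ n := by exact_mod_cast i.pos
  set q : EuclideanSpace ℝ (Fin n) → ℝ := fun y =>
    M * ‖y‖ ^ 2 + (n * M + N / 2) * y i + (-(n * M + N / 2)) * (y i) ^ 2 with hq
  have hqc : ContDiff ℝ 2 q := by
    have := contDiff_norm_sq ℝ (E := EuclideanSpace ℝ (Fin n)) (n := 2)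
    fun_prop
  have hu1 : ContDiff ℝ 2 fun y => u (y + x₀) := hu.comp (contDiff_id.add contDiff_const)
  have hu2 : ContDiff ℝ 2 fun y => u (reflectCoord i y + x₀) :=
    hu1.comp (contDiff_reflectCoord i)
  set w : EuclideanSpace ℝ (Fin n) → ℝ := fun y =>
    2⁻¹ * (u (y + x₀) - u (reflectCoord i y + x₀)) - q y with hw
  have hwc : ContDiff ℝ 2 w := (contDiff_const.mul (hu1.sub hu2)).sub hqc
  have hwl : ∀ y, lap n w y = 2⁻¹ * (lap n u (y + x₀) - lap n u (reflectCoord i y + x₀)) + N := by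
    intro y
    rw [hw, lap_sub (contDiff_const.mul (hu1.sub hu2)) hqc, lap_const_mul (hu1.sub hu2),
      lap_sub hu1 hu2, lap_comp_add hu, lap_comp_reflectCoord hu1 i, lap_comp_add hu,
      hq, lap_quadratic]
    ring
  set K : Set (EuclideanSpace ℝ (Fin n)) := {y | 0 ≤ y i ∧ y i ≤ 1 ∧ ‖y‖ ^ 2 - (y i) ^ 2 ≤ 1}
    with hKdef
  have hKn : ∀ y ∈ K, ‖y‖ ≤ 2 := by
    rintro y ⟨h0, h1, h2⟩
    nlinarith [norm_nonneg y]
  have hKb : ∀ y ∈ K, y + x₀ ∈ closedBall x₀ 2 ∧ reflectCoord i y + x₀ ∈ closedBall x₀ 2 := by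
    intro y hy
    simp only [mem_closedBall, dist_eq_norm, add_sub_cancel_right, norm_reflectCoord]
    exact ⟨hKn y hy, hKn y hy⟩
  have hcoord : Continuous fun y : EuclideanSpace ℝ (Fin n) => y i := by fun_prop
  have hK : IsCompact K := by
    refine Metric.isCompact_of_isClosed_isBounded ?_ ?_
    · exact (isClosed_le continuous_const hcoord).inter
        ((isClosed_le hcoord continuous_const).inter
          (isClosed_le ((continuous_norm.pow 2).sub (hcoord.pow 2)) continuous_const))
    · refine (Metric.isBounded_closedBall (x := (0 : EuclideanSpace ℝ (Fin n))) (r := 2)).subset ?_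
      intro y hy
      simpa using hKn y hy
  have hle : ∀ y ∈ K, w y ≤ 0 := by
    refine nonpos_of_lap_pos hK hwc fun y hy => ?_
    obtain ⟨hb1, hb2⟩ := hKb y hy
    have hm1 := abs_le.1 (hM _ hb1)
    have hm2 := abs_le.1 (hM _ hb2)
    obtain ⟨h0, h1, h2⟩ := hy
    have hyi : (y i) ^ 2 ≤ ‖y‖ ^ 2 := sq_le_sq' (by linarith [norm_nonneg y])
      ((le_abs_self _).trans (abs_coord_le_norm y i))
    rcases h0.eq_or_lt with e0 | h0
    · left
      have : reflectCoord i y = y := by simp [reflectCoord, ← e0]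
      have h3 : q y = M * ‖y‖ ^ 2 := by simp [hq, ← e0]
      simp only [hw, this, h3]
      nlinarith [sq_nonneg ‖y‖, mul_nonneg hM0 (sq_nonneg ‖y‖)]
    rcases h1.eq_or_lt with e1 | h1
    · left
      have h3 : q y = M * ‖y‖ ^ 2 := by simp only [hq, e1]; ring
      have h4 : M * 1 ≤ M * ‖y‖ ^ 2 := mul_le_mul_of_nonneg_left (by nlinarith) hM0
      simp only [hw, h3]
      linarith
    rcases h2.eq_or_lt with e2 | h2
    · left
      have h3 : M ≤ q y := by
        have : ‖y‖ ^ 2 = 1 + (y i) ^ 2 := by linarith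
        simp only [hq, this]
        have h5 : 0 ≤ (n * M + N / 2) * (y i * (1 - y i)) := by
          have : 0 < 1 - y i := by linarith
          positivity
        nlinarith [mul_nonneg hM0 (sq_nonneg (y i))]
      simp only [hw]
      linarith
    · right
      refine ⟨?_, ?_⟩
      · have ho : IsOpen {y : EuclideanSpace ℝ (Fin n) | 0 < y i ∧ y i < 1 ∧
            ‖y‖ ^ 2 - (y i) ^ 2 < 1} :=
          (isOpen_lt continuous_const hcoord).inter
            ((isOpen_lt hcoord continuous_const).inter
              (isOpen_lt ((continuous_norm.pow 2).sub (hcoord.pow 2)) continuous_const))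
        refine Filter.mem_of_superset (ho.mem_nhds ⟨h0, h1, h2⟩) ?_
        rintro z ⟨a, b, c⟩
        exact ⟨a.le, b.le, c.le⟩
      · rw [hwl]
        have l1 := abs_lt.1 (hN _ hb1)
        have l2 := abs_lt.1 (hN _ hb2)
        linarith
  -- differentiate along the coordinate line
  have hder := hasDerivAt_line (hu1.differentiable (by norm_num)) 0 (EuclideanSpace.single i 1) 0
  have hd : Differentiable ℝ u := hu.differentiable (by norm_num)
  have hd1 : HasDerivAt (fun t : ℝ => u (x₀ + t • EuclideanSpace.single i (1:ℝ)))
      (fderiv ℝ u x₀ (EuclideanSpace.single i 1)) 0 := by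
    simpa using hasDerivAt_line hd x₀ (EuclideanSpace.single i (1:ℝ)) 0
  have hd2 : HasDerivAt (fun t : ℝ => u (x₀ + t • (-EuclideanSpace.single i (1:ℝ))))
      (-fderiv ℝ u x₀ (EuclideanSpace.single i 1)) 0 := by
    simpa using hasDerivAt_line hd x₀ (-EuclideanSpace.single i (1:ℝ)) 0
  have hd3 : HasDerivAt (fun t : ℝ => M * t ^ 2 + (n * M + N / 2) * t +
      (-(n * M + N / 2)) * t ^ 2) (n * M + N / 2) 0 := by
    have := ((((hasDerivAt_id (0:ℝ)).pow 2).const_mul M).add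
      ((hasDerivAt_id (0:ℝ)).const_mul (n * M + N / 2))).add
      (((hasDerivAt_id (0:ℝ)).pow 2).const_mul (-(n * M + N / 2)))
    exact this.congr_deriv (by simp)
  have hd4 := ((hd1.sub hd2).const_mul 2⁻¹).sub hd3
  have hle' : ∀ t ∈ Icc (0:ℝ) 1, w (t • EuclideanSpace.single i (1:ℝ)) ≤ 0 := by
    intro t ht
    refine hle _ ⟨?_, ?_, ?_⟩
    · simpa using ht.1
    · simpa using ht.2
    · simp [norm_smul]
  have hweq : ∀ t : ℝ, w (t • EuclideanSpace.single i (1:ℝ)) =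
      2⁻¹ * (u (x₀ + t • EuclideanSpace.single i (1:ℝ)) -
        u (x₀ + t • (-EuclideanSpace.single i (1:ℝ)))) -
      (M * t ^ 2 + (n * M + N / 2) * t + (-(n * M + N / 2)) * t ^ 2) := by
    intro t
    have : reflectCoord i (t • EuclideanSpace.single i (1:ℝ)) =
        t • (-EuclideanSpace.single i (1:ℝ)) := by
      simp only [reflectCoord, PiLp.smul_apply, PiLp.single_apply, if_true, smul_eq_mul]
      module
    simp only [hw, hq, this, add_comm _ x₀]
    simp [norm_smul]
  by_contra! hcon
  have hpos : 0 < 2⁻¹ * (fderiv ℝ u x₀ (EuclideanSpace.single i 1) -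
      -fderiv ℝ u x₀ (EuclideanSpace.single i 1)) - (n * M + N / 2) := by linarith
  have hev := (hd4.tendsto_slope_zero_right).eventually (lt_mem_nhds hpos)
  have hev2 : ∀ᶠ t : ℝ in nhdsWithin 0 (Ioi 0), t ∈ Ioo (0:ℝ) 1 := Ioo_mem_nhdsGT (by norm_num)
  obtain ⟨t, h1, h2⟩ := (hev.and hev2).exists
  have h3 := hle' t ⟨h2.1.le, h2.2.le⟩
  rw [hweq] at h3
  simp at h1 h3
  have h4 := (pos_iff_pos_of_mul_pos h1).1 (inv_pos.2 h2.1)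
  linarith

/-- Interior gradient estimate. -/
lemma abs_partial_deriv_le_of_bounds (hu : ContDiff ℝ 2 u) (i : Fin n) {M N : ℝ}
    {x₀ : EuclideanSpace ℝ (Fin n)} (hM : ∀ x ∈ closedBall x₀ 2, |u x| ≤ M)
    (hN : ∀ x ∈ closedBall x₀ 2, |lap n u x| < N) :
    |fderiv ℝ u x₀ (EuclideanSpace.single i 1)| ≤ n * M + N / 2 := by
  refine abs_le.2 ⟨?_, partial_deriv_le_of_bounds hu i hM hN⟩
  have := partial_deriv_le_of_bounds hu.neg i (M := M) (N := N) (x₀ := x₀)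
    (fun x hx => by simpa using hM x hx)
    (fun x hx => by simpa [lap_neg hu] using hN x hx)
  rw [fderiv_fun_neg] at this
  simp at this
  linarith

end Gradient

/-! ### Harnack inequality -/

section Harnack

variable {n : ℕ} {w : EuclideanSpace ℝ (Fin n) → ℝ}

lemma hasDerivAt_max_zero_sq (s : ℝ) : HasDerivAt (fun s : ℝ => (max 0 s) ^ 2) (2 * max 0 s) s := by
  refine hasDerivAt_of_hasDerivAt_of_ne' (x := 0) (g := fun s => 2 * max 0 s) ?_
    (by fun_prop) (by fun_prop) s
  intro y hy
  rcases lt_or_gt_of_ne hy with h | h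
  · rw [max_eq_left h.le]
    refine ((hasDerivAt_const y (0:ℝ)).congr_of_eventuallyEq ?_).congr_deriv (by simp)
    filter_upwards [gt_mem_nhds h] with z hz
    simp [max_eq_left hz.le]
  · rw [max_eq_right h.le]
    refine ((hasDerivAt_pow 2 y).congr_of_eventuallyEq ?_).congr_deriv (by simp)
    filter_upwards [lt_mem_nhds h] with z hz
    simp [max_eq_right hz.le]

/-- The truncated paraboloid used as an averaging weight. -/
def weight (z : EuclideanSpace ℝ (Fin n)) : ℝ := max 0 (1 - ‖z‖ ^ 2)

lemma continuous_weight : Continuous (weight (n := n)) := by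
  unfold weight; fun_prop

lemma weight_nonneg (z : EuclideanSpace ℝ (Fin n)) : 0 ≤ weight z := le_max_left _ _

lemma weight_le_one (z : EuclideanSpace ℝ (Fin n)) : weight z ≤ 1 :=
  max_le zero_le_one (by linarith [sq_nonneg ‖z‖])

lemma weight_eq_zero {z : EuclideanSpace ℝ (Fin n)} (hz : 1 ≤ ‖z‖) : weight z = 0 :=
  max_eq_left (by nlinarith)

lemma hasCompactSupport_weight : HasCompactSupport (weight (n := n)) := by
  refine HasCompactSupport.intro (isCompact_closedBall 0 1) fun z hz => weight_eq_zero ?_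
  simp at hz
  exact hz.le

lemma integral_weight_pos : 0 < ∫ z, weight (n := n) z := by
  refine (continuous_weight).integral_pos_of_hasCompactSupport_nonneg_nonzero
    hasCompactSupport_weight weight_nonneg (x := 0) ?_
  simp [weight]

lemma hasFDerivAt_weight_sq (z : EuclideanSpace ℝ (Fin n)) :
    HasFDerivAt (fun z : EuclideanSpace ℝ (Fin n) => weight z ^ 2 / 4)
      (-(weight z) • innerSL ℝ z) z := by
  have h1 : HasFDerivAt (fun z : EuclideanSpace ℝ (Fin n) => 1 - ‖z‖ ^ 2)
      (-(2 • innerSL ℝ z)) z := ((hasStrictFDerivAt_norm_sq z).hasFDerivAt).const_sub 1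
  have h2 := ((hasDerivAt_max_zero_sq (1 - ‖z‖ ^ 2)).comp_hasFDerivAt z h1).mul_const (4⁻¹ : ℝ)
  refine (h2.congr_of_eventuallyEq (Eventually.of_forall fun y => by
    simp [weight, div_eq_mul_inv])).congr_fderiv ?_
  ext v
  simp [weight]
  ring

/-- The weighted average of `w` over the ball of radius `r` around `x`, up to normalization. -/
def avg (w : EuclideanSpace ℝ (Fin n) → ℝ) (x : EuclideanSpace ℝ (Fin n)) (r : ℝ) : ℝ :=
  ∫ z, weight z * w (x + r • z)

lemma integrable_weight_mul {f : EuclideanSpace ℝ (Fin n) → ℝ} (hf : Continuous f) :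
    Integrable (fun z => weight z * f z) :=
  (continuous_weight.mul hf).integrable_of_hasCompactSupport hasCompactSupport_weight.mul_right

lemma hasDerivAt_avg (hw : ContDiff ℝ 2 w) (x : EuclideanSpace ℝ (Fin n)) (r : ℝ) :
    HasDerivAt (avg w x) (∫ z, weight z * fderiv ℝ w (x + r • z) z) r := by
  have hd : Differentiable ℝ w := hw.differentiable (by norm_num)
  have hcont : Continuous fun p : ℝ × EuclideanSpace ℝ (Fin n) =>
      fderiv ℝ w (x + p.1 • p.2) p.2 :=
    ((hw.continuous_fderiv (by norm_num)).comp (by fun_prop)).clm_apply continuous_snd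
  obtain ⟨M, hM⟩ := ((isCompact_closedBall r 1).prod
    (isCompact_closedBall (0 : EuclideanSpace ℝ (Fin n)) 1)).exists_bound_of_continuousOn
      hcont.continuousOn
  refine (hasDerivAt_integral_of_dominated_loc_of_deriv_le (s := closedBall r 1)
    (F := fun r z => weight z * w (x + r • z))
    (F' := fun r z => weight z * fderiv ℝ w (x + r • z) z) (bound := fun z => weight z * M)
    (closedBall_mem_nhds r one_pos) (Eventually.of_forall fun r' => ?_) ?_ ?_ ?_ ?_ ?_).2
  · exact (integrable_weight_mul (hw.continuous.comp (by fun_prop))).aestronglyMeasurable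
  · exact integrable_weight_mul (hw.continuous.comp (by fun_prop))
  · exact (integrable_weight_mul (hcont.comp (by fun_prop :
      Continuous fun z : EuclideanSpace ℝ (Fin n) => (r, z)))).aestronglyMeasurable
  · refine Eventually.of_forall fun z r' hr' => ?_
    rcases le_or_gt 1 ‖z‖ with h | h
    · simp [weight_eq_zero h]
    · rw [norm_mul, Real.norm_of_nonneg (weight_nonneg z)]
      exact mul_le_mul_of_nonneg_left (hM (r', z) ⟨hr', by simpa using h.le⟩) (weight_nonneg z)
  · exact integrable_weight_mul continuous_const
  · refine Eventually.of_forall fun z r' _ => ?_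
    have := hasDerivAt_line hd x z r'
    exact this.const_mul _

lemma integral_weight_mul_fderiv (hw : ContDiff ℝ 2 w) (x : EuclideanSpace ℝ (Fin n)) (r : ℝ) :
    ∫ z, weight z * fderiv ℝ w (x + r • z) z =
      r * ∫ z, weight z ^ 2 / 4 * lap n w (x + r • z) := by
  have hG : ∀ i : Fin n, ContDiff ℝ 1 fun z : EuclideanSpace ℝ (Fin n) =>
      fderiv ℝ w (x + r • z) (EuclideanSpace.single i 1) := fun i =>
    (contDiff_fderiv_apply hw _).comp (by fun_prop)
  have hGd : ∀ (i : Fin n) (z : EuclideanSpace ℝ (Fin n)),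
      fderiv ℝ (fun z => fderiv ℝ w (x + r • z) (EuclideanSpace.single i 1)) z
        (EuclideanSpace.single i 1) =
      r * fderiv ℝ (fun y => fderiv ℝ w y (EuclideanSpace.single i 1)) (x + r • z)
        (EuclideanSpace.single i 1) := by
    intro i z
    have h1 : HasFDerivAt (fun z : EuclideanSpace ℝ (Fin n) => x + r • z)
        (r • ContinuousLinearMap.id ℝ _) z := ((hasFDerivAt_id z).const_smul r).const_add x
    have h2 := ((differentiable_fderiv_apply hw (EuclideanSpace.single i 1)
      (x + r • z)).hasFDerivAt).comp z h1
    have h3 := h2.fderiv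
    simp only [Function.comp_def] at h3
    rw [h3]
    simp
  have hc2 : ∀ i : Fin n, Continuous fun z : EuclideanSpace ℝ (Fin n) =>
      fderiv ℝ (fun y => fderiv ℝ w y (EuclideanSpace.single i 1)) (x + r • z)
        (EuclideanSpace.single i 1) := fun i =>
    (((contDiff_fderiv_apply hw _).continuous_fderiv (by norm_num)).comp
      (by fun_prop)).clm_apply continuous_const
  have hP : ∀ z : EuclideanSpace ℝ (Fin n), DifferentiableAt ℝ
      (fun z : EuclideanSpace ℝ (Fin n) => weight z ^ 2 / 4) z := fun z =>
    (hasFDerivAt_weight_sq z).differentiableAt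
  have hinteg2 : ∀ {f : EuclideanSpace ℝ (Fin n) → ℝ}, Continuous f →
      Integrable (fun z => weight z ^ 2 / 4 * f z) := by
    intro f hf
    have := integrable_weight_mul (f := fun z => weight z / 4 * f z)
      ((continuous_weight.div_const 4).mul hf)
    refine this.congr (Eventually.of_forall fun z => ?_)
    simp only
    ring
  have hibp : ∀ i : Fin n,
      ∫ z, weight z * (z i * fderiv ℝ w (x + r • z) (EuclideanSpace.single i 1)) =
      ∫ z, weight z ^ 2 / 4 * (r * fderiv ℝ (fun y => fderiv ℝ w y (EuclideanSpace.single i 1))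
        (x + r • z) (EuclideanSpace.single i 1)) := by
    intro i
    have hder : ∀ z : EuclideanSpace ℝ (Fin n), fderiv ℝ
        (fun z : EuclideanSpace ℝ (Fin n) => weight z ^ 2 / 4) z (EuclideanSpace.single i 1) =
        - (weight z * z i) := by
      intro z
      rw [(hasFDerivAt_weight_sq z).fderiv]
      simp [EuclideanSpace.inner_single_right]
    have := integral_mul_fderiv_eq_neg_fderiv_mul_of_integrable (μ := volume) (𝕜 := ℝ)
      (f := fun z => fderiv ℝ w (x + r • z) (EuclideanSpace.single i 1))
      (g := fun z : EuclideanSpace ℝ (Fin n) => weight z ^ 2 / 4)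
      (v := EuclideanSpace.single i 1) ?_ ?_ ?_ (fun z _ => (hG i).differentiable (by norm_num) z)
      (fun z _ => hP z)
    · simp only [hder, hGd] at this
      rw [← neg_inj, ← integral_neg]
      calc _ = _ := integral_congr_ae (Eventually.of_forall fun z => by simp only; ring)
        _ = _ := this
        _ = _ := by
          congr 1
          exact integral_congr_ae (Eventually.of_forall fun z => by simp only; ring)
    · simp only [hGd]
      have hc3 : Continuous fun z : EuclideanSpace ℝ (Fin n) =>
          r * fderiv ℝ (fun y => fderiv ℝ w y (EuclideanSpace.single i 1)) (x + r • z)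
            (EuclideanSpace.single i 1) := continuous_const.mul (hc2 i)
      refine (hinteg2 hc3).congr (Eventually.of_forall fun z => ?_)
      simp only
      rw [mul_comm]
    · simp only [hder]
      refine (integrable_weight_mul (f := fun z => - z i * fderiv ℝ w (x + r • z)
        (EuclideanSpace.single i 1)) ?_).congr (Eventually.of_forall fun z => ?_)
      · have := (hG i).continuous
        fun_prop
      · simp only; ring
    · refine (hinteg2 (hG i).continuous).congr (Eventually.of_forall fun z => ?_)
      simp only
      rw [mul_comm]
  have hexp : ∀ z : EuclideanSpace ℝ (Fin n), weight z * fderiv ℝ w (x + r • z) z =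
      ∑ i, weight z * (z i * fderiv ℝ w (x + r • z) (EuclideanSpace.single i 1)) := by
    intro z
    rw [← Finset.mul_sum]
    congr 1
    have : ∀ T : EuclideanSpace ℝ (Fin n) →L[ℝ] ℝ,
        T z = ∑ i, z i * T (EuclideanSpace.single i 1) := by
      intro T
      conv_lhs => rw [← (EuclideanSpace.basisFun (Fin n) ℝ).sum_repr z]
      simp
    exact this _
  simp only [hexp]
  rw [integral_finsetSum]
  · simp only [hibp]
    rw [← integral_finsetSum, ← integral_const_mul]
    · refine integral_congr_ae (Eventually.of_forall fun z => ?_)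
      simp only [lap, Finset.mul_sum]
      exact Finset.sum_congr rfl fun i _ => by ring
    · intro i _
      have hc3 : Continuous fun z : EuclideanSpace ℝ (Fin n) =>
          r * fderiv ℝ (fun y => fderiv ℝ w y (EuclideanSpace.single i 1)) (x + r • z)
            (EuclideanSpace.single i 1) := continuous_const.mul (hc2 i)
      exact hinteg2 hc3
  · intro i _
    have := (hG i).continuous
    exact integrable_weight_mul (by fun_prop)

lemma abs_deriv_avg_le (hw : ContDiff ℝ 2 w) {x : EuclideanSpace ℝ (Fin n)} {L ρ r : ℝ}
    (hρ : 0 < ρ) (hr0 : 0 ≤ r) (hr : r ≤ ρ) (h0 : ∀ y ∈ ball x ρ, 0 ≤ w y)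
    (h : ∀ y ∈ ball x ρ, |lap n w y| ≤ L * w y) :
    |r * ∫ z, weight z ^ 2 / 4 * lap n w (x + r • z)| ≤ ρ * L / 4 * avg w x r := by
  have hmem : ∀ z : EuclideanSpace ℝ (Fin n), ‖z‖ < 1 → x + r • z ∈ ball x ρ := by
    intro z hz
    simp only [mem_ball, dist_eq_norm, add_sub_cancel_left, norm_smul, Real.norm_eq_abs,
      abs_of_nonneg hr0]
    nlinarith [norm_nonneg z]
  have hpt : ∀ z : EuclideanSpace ℝ (Fin n),
      ‖weight z ^ 2 / 4 * lap n w (x + r • z)‖ ≤ L / 4 * (weight z * w (x + r • z)) := by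
    intro z
    rcases le_or_gt 1 ‖z‖ with h1 | h1
    · simp [weight_eq_zero h1]
    have h2 := h _ (hmem z h1)
    have h3 := weight_nonneg z
    have h4 := weight_le_one z
    rw [norm_mul, Real.norm_of_nonneg (by positivity), Real.norm_eq_abs]
    calc weight z ^ 2 / 4 * |lap n w (x + r • z)|
        ≤ weight z / 4 * (L * w (x + r • z)) := by
          exact mul_le_mul (by nlinarith) h2 (abs_nonneg _) (by positivity)
      _ = _ := by ring
  have hi : Integrable fun z => L / 4 * (weight z * w (x + r • z)) :=
    (integrable_weight_mul (hw.continuous.comp (by fun_prop))).const_mul _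
  have h1 := norm_integral_le_of_norm_le hi (Eventually.of_forall hpt)
  rw [integral_const_mul, Real.norm_eq_abs] at h1
  rw [abs_mul, abs_of_nonneg hr0]
  have havg : 0 ≤ avg w x r := by
    refine integral_nonneg fun z => ?_
    rcases le_or_gt 1 ‖z‖ with h1 | h1
    · simp [weight_eq_zero h1]
    · exact mul_nonneg (weight_nonneg z) (h0 _ (hmem z h1))
  calc r * _ ≤ ρ * (L / 4 * avg w x r) := by
        refine mul_le_mul hr h1 (abs_nonneg _) hρ.le
    _ = _ := by ring

lemma avg_growth (hw : ContDiff ℝ 2 w) {x : EuclideanSpace ℝ (Fin n)} {L ρ : ℝ}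
    (hρ : 0 < ρ) (h0 : ∀ y ∈ ball x ρ, 0 ≤ w y)
    (h : ∀ y ∈ ball x ρ, |lap n w y| ≤ L * w y) :
    avg w x 0 ≤ Real.exp (ρ * L / 4 * ρ) * avg w x ρ ∧
      avg w x ρ ≤ Real.exp (ρ * L / 4 * ρ) * avg w x 0 := by
  set a := ρ * L / 4 with ha
  have hd := hasDerivAt_avg hw x
  simp only [integral_weight_mul_fderiv hw] at hd
  have hexp : ∀ (s r : ℝ), HasDerivAt (fun r => avg w x r * Real.exp (s * r))
      ((r * ∫ z, weight z ^ 2 / 4 * lap n w (x + r • z)) * Real.exp (s * r) +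
        avg w x r * (Real.exp (s * r) * s)) r := by
    intro s r
    have h1 : HasDerivAt (fun r : ℝ => s * r) s r := by
      simpa using (hasDerivAt_id r).const_mul s
    exact (hd r).mul h1.exp
  have hb : ∀ r ∈ interior (Icc 0 ρ), _ := fun r hr => by
    rw [interior_Icc] at hr
    exact abs_le.1 (abs_deriv_avg_le hw hρ hr.1.le hr.2.le h0 h)
  have hmem0 : (0:ℝ) ∈ Icc 0 ρ := ⟨le_rfl, hρ.le⟩
  have hmem1 : ρ ∈ Icc 0 ρ := ⟨hρ.le, le_rfl⟩
  constructor
  · have hm := monotoneOn_of_deriv_nonneg (convex_Icc 0 ρ)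
      (f := fun r => avg w x r * Real.exp (a * r))
      (fun r _ => (hexp a r).continuousAt.continuousWithinAt)
      (fun r _ => (hexp a r).differentiableAt.differentiableWithinAt)
      (fun r hr => by
        rw [(hexp a r).deriv]
        have := (hb r hr).1
        have he := (Real.exp_pos (a * r)).le
        rw [← ha] at this
        have h2 := mul_le_mul_of_nonneg_right this he
        linarith)
    have := hm hmem0 hmem1 hρ.le
    simp at this
    linarith
  · have hm := antitoneOn_of_deriv_nonpos (convex_Icc 0 ρ)
      (f := fun r => avg w x r * Real.exp (-a * r))
      (fun r _ => (hexp (-a) r).continuousAt.continuousWithinAt)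
      (fun r _ => (hexp (-a) r).differentiableAt.differentiableWithinAt)
      (fun r hr => by
        rw [(hexp (-a) r).deriv]
        have := (hb r hr).2
        have he := (Real.exp_pos (-a * r)).le
        rw [← ha] at this
        have h2 := mul_le_mul_of_nonneg_right this he
        linarith)
    have h1 := hm hmem0 hmem1 hρ.le
    simp only [neg_mul, Real.exp_neg, mul_zero, Real.exp_zero, mul_one] at h1
    rw [← div_eq_mul_inv, div_le_iff₀ (Real.exp_pos _)] at h1
    linarith

lemma avg_zero (x : EuclideanSpace ℝ (Fin n)) : avg w x 0 = w x * ∫ z, weight (n := n) z := by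
  simp only [avg, zero_smul, add_zero, integral_mul_const]
  exact mul_comm _ _

lemma avg_eq (x : EuclideanSpace ℝ (Fin n)) {ρ : ℝ} (hρ : 0 < ρ) :
    avg w x ρ = (ρ ^ n)⁻¹ * ∫ y, weight (ρ⁻¹ • (y - x)) * w y := by
  have h1 := Measure.integral_comp_smul (volume : Measure (EuclideanSpace ℝ (Fin n)))
    (fun y => weight (ρ⁻¹ • y) * w (x + y)) ρ
  simp only [smul_smul, inv_mul_cancel₀ hρ.ne', one_smul, finrank_euclideanSpace,
    Fintype.card_fin, smul_eq_mul] at h1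
  rw [avg, h1, abs_of_pos (by positivity)]
  congr 1
  have h2 := integral_add_left_eq_self (μ := (volume : Measure (EuclideanSpace ℝ (Fin n))))
    (fun y => weight (ρ⁻¹ • (y - x)) * w y) x
  simp only [add_sub_cancel_left] at h2
  exact h2

/-- Harnack inequality for nonnegative functions with `|Δw| ≤ L w`. -/
theorem harnack (n : ℕ) (L : ℝ) {ρ : ℝ} (hρ : 0 < ρ) :
    ∃ C : ℝ, 0 < C ∧ ∀ (w : EuclideanSpace ℝ (Fin n) → ℝ) (c : EuclideanSpace ℝ (Fin n)),
      ContDiff ℝ 2 w → (∀ y ∈ ball c (4 * ρ), 0 ≤ w y) →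
      (∀ y ∈ ball c (4 * ρ), |lap n w y| ≤ L * w y) →
      ∀ x ∈ ball c ρ, w x ≤ C * w c := by
  refine ⟨Real.exp (ρ * L / 4 * ρ) * (4 ^ n * (4 / 3)) *
    Real.exp (4 * ρ * L / 4 * (4 * ρ)), by positivity, ?_⟩
  intro w c hw h0 h x hx
  have hsub : ball x ρ ⊆ ball c (4 * ρ) := by
    intro y hy
    have := dist_triangle y x c
    rw [mem_ball] at *
    linarith
  have h1 := (avg_growth hw hρ (fun y hy => h0 y (hsub hy)) (fun y hy => h y (hsub hy))).1
  have h2 := (avg_growth hw (by positivity : 0 < 4 * ρ) h0 h).2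
  have hcomp : avg w x ρ ≤ 4 ^ n * (4 / 3) * avg w c (4 * ρ) := by
    rw [avg_eq x hρ, avg_eq c (by positivity : 0 < 4 * ρ), mul_pow, mul_inv]
    have hpt : ∀ y, weight (ρ⁻¹ • (y - x)) * w y ≤
        4 / 3 * (weight ((4 * ρ)⁻¹ • (y - c)) * w y) := by
      intro y
      have hnorm : ∀ (s : ℝ) (_ : 0 < s) (p : EuclideanSpace ℝ (Fin n)),
          ‖s⁻¹ • (y - p)‖ = dist y p / s := by
        intro s hs p
        rw [norm_smul, norm_inv, Real.norm_of_nonneg hs.le, dist_eq_norm]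
        field_simp
      have e1 := hnorm ρ hρ x
      have e2 := hnorm (4 * ρ) (by positivity) c
      have hrhs : 0 ≤ weight ((4 * ρ)⁻¹ • (y - c)) * w y := by
        rcases le_or_gt 1 ‖(4 * ρ)⁻¹ • (y - c)‖ with h3 | h3
        · rw [weight_eq_zero h3, zero_mul]
        · refine mul_nonneg (weight_nonneg _) (h0 y ?_)
          rw [e2, div_lt_one (by positivity)] at h3
          exact h3
      rcases le_or_gt 1 ‖ρ⁻¹ • (y - x)‖ with h3 | h3
      · simp only [weight_eq_zero h3, zero_mul]
        positivity
      · rw [e1, div_lt_one hρ] at h3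
        have h4 : dist y c / (4 * ρ) ≤ 1 / 2 := by
          rw [div_le_iff₀ (by positivity)]
          have := dist_triangle y x c
          rw [mem_ball] at hx
          linarith
        have h5 : 3 / 4 ≤ weight ((4 * ρ)⁻¹ • (y - c)) := by
          refine le_max_of_le_right ?_
          rw [e2]
          have : 0 ≤ dist y c / (4 * ρ) := by positivity
          nlinarith
        have h6 : 0 ≤ w y := h0 y (hsub h3)
        have h7 := weight_le_one (ρ⁻¹ • (y - x))
        nlinarith
    have hinteg : ∀ (s : ℝ) (_ : 0 < s) (p : EuclideanSpace ℝ (Fin n)),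
        Integrable fun y => weight (s⁻¹ • (y - p)) * w y := by
      intro s hs p
      refine Continuous.integrable_of_hasCompactSupport ?_ (HasCompactSupport.mul_right ?_)
      · exact (continuous_weight.comp (by fun_prop)).mul hw.continuous
      · refine HasCompactSupport.intro (isCompact_closedBall p s) fun y hy => weight_eq_zero ?_
        rw [norm_smul, norm_inv, Real.norm_of_nonneg hs.le, ← dist_eq_norm, inv_mul_eq_div,
          one_le_div hs]
        simp at hy
        exact hy.le
    have h3 := integral_mono (hinteg ρ hρ x)
      ((hinteg (4 * ρ) (by positivity) c).const_mul (4 / 3)) hpt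
    rw [integral_const_mul] at h3
    calc (ρ ^ n)⁻¹ * ∫ y, weight (ρ⁻¹ • (y - x)) * w y
        ≤ (ρ ^ n)⁻¹ * (4 / 3 * ∫ y, weight ((4 * ρ)⁻¹ • (y - c)) * w y) :=
          mul_le_mul_of_nonneg_left h3 (by positivity)
      _ = _ := by field_simp
  rw [avg_zero] at h1 h2
  have hI := integral_weight_pos (n := n)
  refine le_of_mul_le_mul_right ?_ hI
  calc w x * ∫ z, weight (n := n) z
      ≤ Real.exp (ρ * L / 4 * ρ) * avg w x ρ := h1
    _ ≤ Real.exp (ρ * L / 4 * ρ) * (4 ^ n * (4 / 3) * avg w c (4 * ρ)) := by gcongr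
    _ ≤ Real.exp (ρ * L / 4 * ρ) * (4 ^ n * (4 / 3) *
        (Real.exp (4 * ρ * L / 4 * (4 * ρ)) * (w c * ∫ z, weight (n := n) z))) := by gcongr
    _ = _ := by ring

end Harnack

/-! ### Extension of the nonlinearity -/

/-- `f` is a globally defined `C¹` nonlinearity with derivative `V`, which vanishes at `±1` with
positive slope. -/
structure IsBistable (f V : ℝ → ℝ) (L : ℝ) : Prop where
  hasDerivAt : ∀ s, HasDerivAt f (V s) s
  uniformContinuous : UniformContinuous V
  pos : 0 < L
  abs_le : ∀ s, |V s| ≤ L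
  zero_left : f (-1) = 0
  zero_right : f 1 = 0
  pos_left : 0 < V (-1)
  pos_right : 0 < V 1

lemma eq_of_continuousOn_Icc_of_eqOn_Ioo {f g : ℝ → ℝ} {a b x : ℝ} (hab : a < b)
    (hx : x ∈ Icc a b) (hf : ContinuousOn f (Icc a b)) (hg : ContinuousAt g x)
    (h : EqOn f g (Ioo a b)) : f x = g x := by
  have : (nhdsWithin x (Ioo a b)).NeBot := by
    rw [← mem_closure_iff_nhdsWithin_neBot, closure_Ioo hab.ne]
    exact hx
  refine tendsto_nhds_unique_of_eventuallyEq (l := nhdsWithin x (Ioo a b))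
    ((hf x hx).mono_left (nhdsWithin_mono _ Ioo_subset_Icc_self))
    (hg.tendsto.mono_left nhdsWithin_le_nhds) ?_
  filter_upwards [self_mem_nhdsWithin] with y hy using h hy

theorem DoubleWell.exists_isBistable {W : ℝ → ℝ} (hW : DoubleWell W) :
    ∃ f V : ℝ → ℝ, ∃ L : ℝ, IsBistable f V L ∧ ∀ s ∈ Icc (-1 : ℝ) 1, f s = deriv W s := by
  obtain ⟨hW2, -, -, -, hl, hr, hl2, hr2⟩ := hW
  have h11 : (-1 : ℝ) < 1 := by norm_num
  have hmemL : (-1 : ℝ) ∈ Icc (-1 : ℝ) 1 := left_mem_Icc.2 h11.le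
  have hmemR : (1 : ℝ) ∈ Icc (-1 : ℝ) 1 := right_mem_Icc.2 h11.le
  have hu := uniqueDiffOn_Icc h11
  set I := Icc (-1 : ℝ) 1 with hI
  set D := derivWithin W I with hD
  have hD1 : ContDiffOn ℝ 1 D I := hW2.derivWithin hu (by norm_num)
  have hDd : DifferentiableOn ℝ D I := hD1.differentiableOn (by norm_num)
  have hV0 : ContinuousOn (derivWithin D I) I := hD1.continuousOn_derivWithin hu (by norm_num)
  have hDW : EqOn D (deriv W) (Ioo (-1) 1) := fun s hs =>
    derivWithin_of_mem_nhds (Icc_mem_nhds hs.1 hs.2)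
  have hdiffL : DifferentiableAt ℝ (deriv W) (-1) := by
    by_contra h; rw [deriv_zero_of_not_differentiableAt h] at hl2; exact hl2.false
  have hdiffR : DifferentiableAt ℝ (deriv W) 1 := by
    by_contra h; rw [deriv_zero_of_not_differentiableAt h] at hr2; exact hr2.false
  have hDL : D (-1) = deriv W (-1) := eq_of_continuousOn_Icc_of_eqOn_Ioo h11 hmemL
    hDd.continuousOn hdiffL.continuousAt hDW
  have hDR : D 1 = deriv W 1 := eq_of_continuousOn_Icc_of_eqOn_Ioo h11 hmemR
    hDd.continuousOn hdiffR.continuousAt hDW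
  have hDI : ∀ s ∈ I, D s = deriv W s := by
    intro s hs
    rcases eq_or_lt_of_le hs.1 with h | h
    · rw [← h, hDL]
    rcases eq_or_lt_of_le hs.2 with h' | h'
    · rw [h', hDR]
    exact hDW ⟨h, h'⟩
  set V : ℝ → ℝ := IccExtend h11.le (I.domRestrict (derivWithin D I)) with hV
  have hres : Continuous (I.domRestrict (derivWithin D I)) := hV0.domRestrict
  have hVu : UniformContinuous V :=
    (CompactSpace.uniformContinuous_of_continuous hres).comp
      (LipschitzWith.projIcc h11.le).uniformContinuous
  have hVI : ∀ s ∈ I, V s = derivWithin D I s := fun s hs => IccExtend_of_mem _ _ hs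
  obtain ⟨L, hL⟩ := (isCompact_Icc (a := (-1 : ℝ)) (b := 1)).exists_bound_of_continuousOn hV0
  set f : ℝ → ℝ := fun s => D (-1) + ∫ t in (-1)..s, V t with hf
  have hfd : ∀ s, HasDerivAt f (V s) s := fun s =>
    (hVu.continuous.integral_hasStrictDerivAt (-1) s).hasDerivAt.const_add _
  have hfD : ∀ s ∈ I, f s = D s := by
    refine eq_of_derivWithin_eq (fun s _ => (hfd s).differentiableAt.differentiableWithinAt) hDd
      (fun s hs => ?_) (by simp [hf])
    have hs' : s ∈ I := ⟨hs.1, hs.2.le⟩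
    rw [(hfd s).hasDerivWithinAt.derivWithin (hu s hs'), hVI s hs']
  have hfW : ∀ s ∈ I, f s = deriv W s := fun s hs => (hfD s hs).trans (hDI s hs)
  have hVend : ∀ s ∈ I, DifferentiableAt ℝ (deriv W) s → V s = deriv (deriv W) s := by
    intro s hs hd
    exact (hu s hs).eq_deriv _ ((hfd s).hasDerivWithinAt)
      (hd.hasDerivAt.hasDerivWithinAt.congr hfW (hfW s hs))
  refine ⟨f, V, |L| + 1, ⟨hfd, hVu, by positivity, fun s => ?_, ?_, ?_, ?_, ?_⟩, hfW⟩
  · exact ((hL _ (projIcc (-1) 1 h11.le s).2).trans (le_abs_self L)).trans (by linarith)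
  · rw [hfW _ hmemL, hl]
  · rw [hfW _ hmemR, hr]
  · rwa [hVend _ hmemL hdiffL]
  · rwa [hVend _ hmemR hdiffR]

namespace IsBistable

variable {f V : ℝ → ℝ} {L : ℝ}

lemma continuous (h : IsBistable f V L) : Continuous f :=
  continuous_iff_continuousAt.2 fun s => (h.hasDerivAt s).continuousAt

lemma abs_sub_le (h : IsBistable f V L) (s t : ℝ) : |f s - f t| ≤ L * |s - t| := by
  have := convex_univ.norm_image_sub_le_of_norm_hasDerivWithin_le (f := f) (f' := V) (C := L)
    (s := univ) (fun x _ => (h.hasDerivAt x).hasDerivWithinAt) (fun x _ => h.abs_le x)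
    (mem_univ t) (mem_univ s)
  simpa using this

/-- The reflected nonlinearity. -/
lemma reflect (h : IsBistable f V L) : IsBistable (fun s => - f (-s)) (fun s => V (-s)) L where
  hasDerivAt s := by
    have := ((h.hasDerivAt (-s)).comp s (hasDerivAt_neg s)).neg
    exact this.congr_deriv (by ring)
  uniformContinuous := h.uniformContinuous.comp uniformContinuous_neg
  pos := h.pos
  abs_le s := h.abs_le _
  zero_left := by simp [h.zero_right]
  zero_right := by simp [h.zero_left]
  pos_left := by simpa using h.pos_right
  pos_right := by simpa using h.pos_left

end IsBistable

/-! ### The one-dimensional profile -/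

/-- `g` is an increasing heteroclinic solution of `g'' = f(g)` with derivative `g1`. -/
structure IsProfile (f g g1 : ℝ → ℝ) : Prop where
  hasDerivAt : ∀ t, HasDerivAt g (g1 t) t
  hasDerivAt_deriv : ∀ t, HasDerivAt g1 (f (g t)) t
  deriv_pos : ∀ t, 0 < g1 t
  mem_Ioo : ∀ t, g t ∈ Ioo (-1 : ℝ) 1
  zero : g 0 = 0
  tendsto_atTop : Tendsto g atTop (nhds 1)
  tendsto_atBot : Tendsto g atBot (nhds (-1))

lemma IsOneDSolution.isProfile {W f g : ℝ → ℝ} (hg : IsOneDSolution W g)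
    (hf : ∀ s ∈ Icc (-1 : ℝ) 1, f s = deriv W s) : IsProfile f g (deriv g) := by
  obtain ⟨h1, h2, h3, h4, h5, h6, h7⟩ := hg
  refine ⟨fun t => (h1.differentiable (by norm_num) t).hasDerivAt, fun t => ?_, h4, h2, h5, h6, h7⟩
  have hd : ContDiff ℝ 1 (deriv g) := by
    have : ContDiff ℝ (1 + 1) g := h1.of_le (by norm_num)
    exact (contDiff_succ_iff_deriv.1 this).2.2
  have := (hd.differentiable (by norm_num) t).hasDerivAt
  rwa [h3 t, ← hf _ ⟨(h2 t).1.le, (h2 t).2.le⟩] at this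

namespace IsProfile

variable {f V g g1 : ℝ → ℝ} {L : ℝ}

lemma reflect (hg : IsProfile f g g1) :
    IsProfile (fun s => - f (-s)) (fun t => - g (-t)) (fun t => g1 (-t)) where
  hasDerivAt t := by
    have := ((hg.hasDerivAt (-t)).comp t (hasDerivAt_neg t)).neg
    exact this.congr_deriv (by ring)
  hasDerivAt_deriv t := by
    have := (hg.hasDerivAt_deriv (-t)).comp t (hasDerivAt_neg t)
    exact this.congr_deriv (by simp)
  deriv_pos t := hg.deriv_pos _
  mem_Ioo t := ⟨by linarith [(hg.mem_Ioo (-t)).2], by linarith [(hg.mem_Ioo (-t)).1]⟩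
  zero := by simp [hg.zero]
  tendsto_atTop := by
    have := (hg.tendsto_atBot.comp tendsto_neg_atTop_atBot).neg
    rw [neg_neg] at this
    exact this
  tendsto_atBot := (hg.tendsto_atTop.comp tendsto_neg_atBot_atTop).neg

lemma continuous (hg : IsProfile f g g1) : Continuous g :=
  continuous_iff_continuousAt.2 fun s => (hg.hasDerivAt s).continuousAt

lemma continuous_deriv (hg : IsProfile f g g1) : Continuous g1 :=
  continuous_iff_continuousAt.2 fun s => (hg.hasDerivAt_deriv s).continuousAt

lemma strictMono (hg : IsProfile f g g1) : StrictMono g :=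
  strictMono_of_hasDerivAt_pos (f' := g1) hg.hasDerivAt hg.deriv_pos

lemma tail_bounds (hf : IsBistable f V L) (hg : IsProfile f g g1) :
    ∃ T Λ a : ℝ, 0 < T ∧ 0 < a ∧ ∀ t ≤ -T,
      |f (g t)| ≤ Λ * g1 t ∧ a ≤ V (g t) ∧ |t| * g1 t ≤ Λ := by
  set a := V (-1) / 2 with ha
  have hap : 0 < a := half_pos hf.pos_left
  obtain ⟨δ, hδ, hVδ⟩ : ∃ δ > 0, ∀ s, |s - (-1)| < δ → a < V s := by
    have := hf.uniformContinuous.continuous.continuousAt.eventually_mem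
      (Ioi_mem_nhds (half_lt_self hf.pos_left))
    obtain ⟨δ, hδ, h⟩ := Metric.eventually_nhds_iff.1 this
    exact ⟨δ, hδ, fun s hs => h (by simpa [Real.dist_eq] using hs)⟩
  obtain ⟨T, hT, hgT⟩ : ∃ T > 0, ∀ t ≤ -T, |g t - (-1)| < δ := by
    have := hg.tendsto_atBot.eventually (Metric.ball_mem_nhds _ hδ)
    obtain ⟨T, hT⟩ := eventually_atBot.1 this
    refine ⟨max 1 (-T), by positivity, fun t ht => ?_⟩
    have := hT t (by linarith [le_max_right 1 (-T)])
    simpa [Real.dist_eq] using this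
  have hfa : ∀ t ≤ -T, a * (1 + g t) ≤ f (g t) := by
    intro t ht
    have h1 := hgT t ht
    have h2 := (hg.mem_Ioo t).1
    have hm : MonotoneOn (fun s => f s - a * s) (Icc (-1) (g t)) := by
      have hd : ∀ s, HasDerivAt (fun s => f s - a * s) (V s - a) s := fun s =>
        ((hf.hasDerivAt s).sub ((hasDerivAt_id s).const_mul a)).congr_deriv (by simp)
      refine monotoneOn_of_deriv_nonneg (convex_Icc _ _)
        (fun s _ => (hd s).continuousAt.continuousWithinAt)
        (fun s _ => (hd s).differentiableAt.differentiableWithinAt) fun s hs => ?_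
      rw [interior_Icc] at hs
      rw [(hd s).deriv, sub_nonneg]
      refine (hVδ s ?_).le
      rw [abs_of_pos (by linarith)] at h1
      rw [abs_of_pos (by linarith [hs.1])]
      linarith [hs.2]
    have := hm ⟨le_rfl, h2.le⟩ ⟨h2.le, le_rfl⟩ h2.le
    simp only [hf.zero_left] at this
    linarith
  have hLf : ∀ t, |f (g t)| ≤ L * (1 + g t) := by
    intro t
    have := hf.abs_sub_le (g t) (-1)
    rw [hf.zero_left, sub_zero, abs_of_pos (a := g t - -1) (by linarith [(hg.mem_Ioo t).1])] at this
    linarith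
  have hmono : MonotoneOn g1 (Iic (-T)) := by
    refine monotoneOn_of_deriv_nonneg (convex_Iic _) hg.continuous_deriv.continuousOn
        (fun s _ => (hg.hasDerivAt_deriv s).differentiableAt.differentiableWithinAt) fun s hs => ?_
    rw [interior_Iic] at hs
    rw [(hg.hasDerivAt_deriv s).deriv]
    have := hfa s (le_of_lt hs)
    have h2 := (hg.mem_Ioo s).1
    have : 0 ≤ a * (1 + g s) := mul_nonneg hap.le (by linarith)
    linarith
  have hdecay : ∀ t ≤ -(2 * T), |t| * g1 t ≤ 4 := by
    intro t ht
    have ht0 : t < t / 2 := by linarith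
    obtain ⟨s, hs, hsd⟩ := exists_hasDerivAt_eq_slope g g1 ht0 hg.continuous.continuousOn
      (fun x _ => hg.hasDerivAt x)
    have h1 : g1 t ≤ g1 s := hmono (by simp only [mem_Iic]; linarith)
      (by simp only [mem_Iic]; linarith [hs.2]) hs.1.le
    rw [hsd, le_div_iff₀ (by linarith)] at h1
    have h2 := (hg.mem_Ioo t).1
    have h3 := (hg.mem_Ioo (t / 2)).2
    rw [abs_of_neg (by linarith)]
    linarith
  have hlim : Tendsto g1 atBot (nhds 0) := by
    have h1 : Tendsto (fun t : ℝ => 4 / (-t)) atBot (nhds 0) :=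
      tendsto_const_nhds.div_atTop tendsto_neg_atBot_atTop
    refine tendsto_of_tendsto_of_tendsto_of_le_of_le' tendsto_const_nhds h1
      (Eventually.of_forall fun t => (hg.deriv_pos t).le) ?_
    filter_upwards [eventually_le_atBot (-(2 * T))] with t ht
    have := hdecay t ht
    rw [abs_of_neg (by linarith)] at this
    rw [le_div_iff₀ (by linarith)]
    linarith
  have hE : ∀ t ≤ -T, a * (1 + g t) ^ 2 ≤ g1 t ^ 2 := by
    have hd : ∀ t, HasDerivAt (fun t => g1 t ^ 2 - a * (1 + g t) ^ 2)
        (2 * g1 t * (f (g t) - a * (1 + g t))) t := fun t => by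
      have h1 := (hg.hasDerivAt_deriv t).pow 2
      have h2 := (((hg.hasDerivAt t).const_add 1).pow 2).const_mul a
      exact (h1.sub h2).congr_deriv (by ring)
    have hm : MonotoneOn (fun t => g1 t ^ 2 - a * (1 + g t) ^ 2) (Iic (-T)) := by
      refine monotoneOn_of_deriv_nonneg (convex_Iic _)
        (fun s _ => (hd s).continuousAt.continuousWithinAt)
        (fun s _ => (hd s).differentiableAt.differentiableWithinAt) fun s hs => ?_
      rw [interior_Iic] at hs
      rw [(hd s).deriv]
      have := hfa s (le_of_lt hs)
      have h2 := hg.deriv_pos s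
      exact mul_nonneg (by positivity) (by linarith)
    have hl : Tendsto (fun t => g1 t ^ 2 - a * (1 + g t) ^ 2) atBot (nhds 0) := by
      have := (hlim.pow 2).sub (((hg.tendsto_atBot.const_add 1).pow 2).const_mul a)
      simpa using this
    intro t ht
    have : 0 ≤ g1 t ^ 2 - a * (1 + g t) ^ 2 := by
      refine le_of_tendsto hl ?_
      filter_upwards [eventually_le_atBot t] with s hs
      exact hm (by simp only [mem_Iic]; linarith) ht hs
    linarith
  have hsq : 0 < √a := Real.sqrt_pos.2 hap
  refine ⟨2 * T, max (L / √a) 4, a, by positivity, hap, fun t ht => ⟨?_, ?_, ?_⟩⟩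
  · have h1 : √a * (1 + g t) ≤ g1 t := by
      refine abs_le_of_sq_le_sq' ?_ (hg.deriv_pos t).le |>.2
      rw [mul_pow, Real.sq_sqrt hap.le]
      exact hE t (by linarith)
    calc |f (g t)| ≤ L * (1 + g t) := hLf t
      _ = L / √a * (√a * (1 + g t)) := by field_simp
      _ ≤ L / √a * g1 t := mul_le_mul_of_nonneg_left h1 (div_nonneg hf.pos.le hsq.le)
      _ ≤ _ := mul_le_mul_of_nonneg_right (le_max_left _ _) (hg.deriv_pos t).le
  · exact (hVδ _ (hgT t (by linarith))).le
  · exact (hdecay t ht).trans (le_max_right _ _)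

/-- Global bounds on a profile. -/
lemma exists_bounds (hf : IsBistable f V L) (hg : IsProfile f g g1) :
    ∃ T Λ a : ℝ, 0 < T ∧ 0 < Λ ∧ 0 < a ∧ (∀ t, |f (g t)| ≤ Λ * g1 t) ∧
      (∀ t, T ≤ |t| → a ≤ V (g t)) ∧ (∀ t, |t| * g1 t ≤ Λ) ∧ ∀ t, g1 t ≤ Λ := by
  obtain ⟨T₁, Λ₁, a₁, hT₁, ha₁, h₁⟩ := hg.tail_bounds hf
  obtain ⟨T₂, Λ₂, a₂, hT₂, ha₂, h₂⟩ := hg.reflect.tail_bounds hf.reflect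
  set T := max 1 (max T₁ T₂) with hT
  have hT1 : 1 ≤ T := le_max_left _ _
  have hTT₁ : T₁ ≤ T := (le_max_left _ _).trans (le_max_right _ _)
  have hTT₂ : T₂ ≤ T := (le_max_right _ _).trans (le_max_right _ _)
  have hne : ∀ t, g1 t ≠ 0 := fun t => (hg.deriv_pos t).ne'
  have hcg := hg.continuous
  have hcg1 := hg.continuous_deriv
  have hcf := hf.continuous
  obtain ⟨M₁, hM₁⟩ := (isCompact_Icc (a := -T) (b := T)).exists_bound_of_continuousOn
    (f := fun t => f (g t) / g1 t) ((hcf.comp hcg).div hcg1 hne).continuousOn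
  obtain ⟨M₂, hM₂⟩ := (isCompact_Icc (a := -T) (b := T)).exists_bound_of_continuousOn
    hcg1.continuousOn
  have hM₁0 : 0 ≤ M₁ := (norm_nonneg _).trans (hM₁ 0 ⟨by linarith, by linarith⟩)
  have hM₂0 : 0 ≤ M₂ := (norm_nonneg _).trans (hM₂ 0 ⟨by linarith, by linarith⟩)
  set Λ := |Λ₁| + |Λ₂| + M₁ + T * M₂ + 1 with hΛ
  have hTM : M₂ ≤ T * M₂ := le_mul_of_one_le_left hM₂0 hT1
  have b1 : Λ₁ ≤ Λ := by linarith [le_abs_self Λ₁, abs_nonneg Λ₂]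
  have b2 : Λ₂ ≤ Λ := by linarith [le_abs_self Λ₂, abs_nonneg Λ₁]
  have b3 : M₁ ≤ Λ := by linarith [abs_nonneg Λ₂, abs_nonneg Λ₁]
  have b4 : T * M₂ ≤ Λ := by linarith [abs_nonneg Λ₂, abs_nonneg Λ₁]
  have hpos := fun t => (hg.deriv_pos t).le
  have key : ∀ t, |f (g t)| ≤ Λ * g1 t ∧ (T ≤ |t| → min a₁ a₂ ≤ V (g t)) ∧ |t| * g1 t ≤ Λ := by
    intro t
    by_cases hl : t ≤ -T
    · obtain ⟨x, y, z⟩ := h₁ t (by linarith)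
      exact ⟨x.trans (mul_le_mul_of_nonneg_right b1 (hpos t)), fun _ => (min_le_left _ _).trans y,
        z.trans b1⟩
    by_cases hr : T ≤ t
    · obtain ⟨x, y, z⟩ := h₂ (-t) (by linarith)
      simp only [neg_neg, abs_neg] at x y z
      exact ⟨x.trans (mul_le_mul_of_nonneg_right b2 (hpos t)), fun _ => (min_le_right _ _).trans y,
        z.trans b2⟩
    push Not at hl hr
    have hmem : t ∈ Icc (-T) T := ⟨hl.le, hr.le⟩
    refine ⟨?_, fun h => absurd (abs_lt.2 ⟨hl, hr⟩) (not_lt.2 h), ?_⟩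
    · have := hM₁ t hmem
      rw [norm_div, Real.norm_eq_abs, Real.norm_of_nonneg (hpos t),
        div_le_iff₀ (hg.deriv_pos t)] at this
      exact this.trans (mul_le_mul_of_nonneg_right b3 (hpos t))
    · have := hM₂ t hmem
      rw [Real.norm_of_nonneg (hpos t)] at this
      exact (mul_le_mul (abs_lt.2 ⟨hl, hr⟩).le this (hpos t) (by linarith)).trans b4
  refine ⟨T, Λ, min a₁ a₂, by linarith, by positivity, lt_min ha₁ ha₂, fun t => (key t).1,
    fun t => (key t).2.1, fun t => (key t).2.2, fun t => ?_⟩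
  by_cases ht : |t| ≤ T
  · have := hM₂ t ⟨(abs_le.1 ht).1, (abs_le.1 ht).2⟩
    rw [Real.norm_of_nonneg (hpos t)] at this
    linarith
  · have := (key t).2.2
    push Not at ht
    have := hpos t
    nlinarith

end IsProfile

/-! ### One-dimensional barriers -/

lemma contDiff_two_of_hasDerivAt {ψ ψ₁ ψ₂ : ℝ → ℝ} (h1 : ∀ t, HasDerivAt ψ (ψ₁ t) t)
    (h2 : ∀ t, HasDerivAt ψ₁ (ψ₂ t) t) (h3 : Continuous ψ₂) : ContDiff ℝ 2 ψ := by
  have e1 : deriv ψ = ψ₁ := funext fun t => (h1 t).deriv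
  have e2 : deriv ψ₁ = ψ₂ := funext fun t => (h2 t).deriv
  have c1 : ContDiff ℝ 1 ψ₁ := contDiff_one_iff_deriv.2
    ⟨fun t => (h2 t).differentiableAt, e2 ▸ h3⟩
  have : ContDiff ℝ (1 + 1) ψ := contDiff_succ_iff_deriv.2
    ⟨fun t => (h1 t).differentiableAt, by simp, e1 ▸ c1⟩
  exact this.of_le (by norm_num)

namespace IsProfile

variable {f V g g1 : ℝ → ℝ} {L : ℝ}

/-- The one-sided correction of the profile: it vanishes at `0`, is close to `1` at infinity and
is a strict supersolution of the linearized equation on the half-line `lam * t ≤ 0`. -/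
def corr (g1 : ℝ → ℝ) (B lam t : ℝ) : ℝ :=
  1 + g1 t * (B * (1 - Real.exp (lam * t)) - 1 / g1 0)

/-- The derivative of `corr`. -/
def corr₁ (f g g1 : ℝ → ℝ) (B lam t : ℝ) : ℝ :=
  f (g t) * (B * (1 - Real.exp (lam * t)) - 1 / g1 0) - g1 t * (B * lam * Real.exp (lam * t))

/-- The second derivative of `corr`. -/
def corr₂ (f V g g1 : ℝ → ℝ) (B lam t : ℝ) : ℝ :=
  V (g t) * (corr g1 B lam t - 1) -
    B * Real.exp (lam * t) * (2 * lam * f (g t) + lam ^ 2 * g1 t)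

lemma hasDerivAt_corr_aux (B lam k t : ℝ) : HasDerivAt (fun t => B * (1 - Real.exp (lam * t)) - k)
    (- (B * lam * Real.exp (lam * t))) t := by
  have h1 : HasDerivAt (fun r : ℝ => lam * r) lam t := by
    simpa using (hasDerivAt_id t).const_mul lam
  exact (((h1.exp.const_sub 1).const_mul B).sub_const k).congr_deriv (by ring)

lemma hasDerivAt_corr (hg : IsProfile f g g1) (B lam t : ℝ) :
    HasDerivAt (corr g1 B lam) (corr₁ f g g1 B lam t) t := by
  have := ((hg.hasDerivAt_deriv t).mul (hasDerivAt_corr_aux B lam (1 / g1 0) t)).const_add 1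
  exact this.congr_deriv (by simp only [corr₁]; ring)

lemma hasDerivAt_corr₁ (hf : IsBistable f V L) (hg : IsProfile f g g1) (B lam t : ℝ) :
    HasDerivAt (corr₁ f g g1 B lam) (corr₂ f V g g1 B lam t) t := by
  have h1 : HasDerivAt (fun r : ℝ => lam * r) lam t := by
    simpa using (hasDerivAt_id t).const_mul lam
  have h2 := ((hf.hasDerivAt (g t)).comp t (hg.hasDerivAt t)).mul
    (hasDerivAt_corr_aux B lam (1 / g1 0) t)
  have h3 := (hg.hasDerivAt_deriv t).mul (h1.exp.const_mul (B * lam))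
  exact (h2.sub h3).congr_deriv (by simp only [corr₂, corr, Function.comp]; ring)

lemma continuous_corr₂ (hf : IsBistable f V L) (hg : IsProfile f g g1) (B lam : ℝ) :
    Continuous (corr₂ f V g g1 B lam) := by
  have h1 := hf.continuous.comp hg.continuous
  have h2 := hf.uniformContinuous.continuous.comp hg.continuous
  have h3 := hg.continuous_deriv
  unfold corr₂ corr
  exact (h2.mul (by fun_prop)).sub ((by fun_prop : Continuous fun t => B * Real.exp (lam * t)).mul
    ((continuous_const.mul h1).add (by fun_prop)))

/-- The main properties of the corrections. -/
lemma exists_corr (hf : IsBistable f V L) (hg : IsProfile f g g1) :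
    ∃ B μ Q T a : ℝ, 0 < μ ∧ 0 < Q ∧ 0 < T ∧ 0 < a ∧
      ∀ lam t, (lam = μ ∨ lam = -μ) → lam * t ≤ 0 →
        corr₂ f V g g1 B lam t - V (g t) * corr g1 B lam t ≤ - a ∧
        |corr g1 B lam t| ≤ Q ∧ |corr₁ f g g1 B lam t| ≤ Q ∧ |t * corr₂ f V g g1 B lam t| ≤ Q ∧
        (T ≤ |t| → 1 / 2 ≤ corr g1 B lam t) := by
  obtain ⟨T, Λ, a, hT, hΛ, ha, hfg, hV, htg, hg1⟩ := hg.exists_bounds hf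
  set μ := 4 * Λ with hμ
  have hμp : 0 < μ := by positivity
  obtain ⟨m, hm, hmT⟩ : ∃ m > 0, ∀ t ∈ Icc (-T) T, m ≤ g1 t := by
    obtain ⟨s, -, hs⟩ := (isCompact_Icc (a := -T) (b := T)).exists_isMinOn
      ⟨0, by constructor <;> linarith⟩ hg.continuous_deriv.continuousOn
    exact ⟨g1 s, hg.deriv_pos s, fun t ht => hs ht⟩
  set k := 1 / g1 0 with hk
  have hkp : 0 < k := one_div_pos.2 (hg.deriv_pos 0)
  set N := Real.exp (-(μ * T)) * (8 * Λ ^ 2 * m) with hN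
  have hNp : 0 < N := by positivity
  set B := (L + a) / N with hB
  have hL := hf.pos
  have hBp : 0 < B := by positivity
  set P := B + k with hP
  have hPp : 0 < P := by positivity
  set S := L * P + B * (2 * μ * Λ + μ ^ 2) with hS
  have hSp : 0 < S := by positivity
  refine ⟨B, μ, 1 + Λ * P + (Λ * Λ * P + Λ * (B * μ)) + Λ * S, max T (2 * (Λ * P)), a, hμp,
    by positivity, by positivity, ha, fun lam t hlam ht => ?_⟩
  have hlam' : |lam| = μ := by
    rcases hlam with h | h <;> simp [h, abs_of_pos hμp]
  have hlam2 : lam ^ 2 = μ ^ 2 := by rw [← sq_abs, hlam']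
  set e := Real.exp (lam * t) with he
  have he0 : 0 < e := Real.exp_pos _
  have he1 : e ≤ 1 := Real.exp_le_one_iff.2 ht
  have hp := hg.deriv_pos t
  have hB1 : |B * (1 - e) - k| ≤ P := by
    have h1 : 0 ≤ B * (1 - e) := mul_nonneg hBp.le (by linarith)
    have h2 : 0 ≤ B * e := by positivity
    rw [abs_le]; constructor <;> linarith
  have hq1 : |corr g1 B lam t - 1| ≤ g1 t * P := by
    simp only [corr, add_sub_cancel_left, abs_mul, abs_of_pos hp]
    exact mul_le_mul_of_nonneg_left hB1 hp.le
  have hlf : |2 * lam * f (g t)| ≤ 2 * μ * (Λ * g1 t) := by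
    rw [abs_mul, abs_mul, hlam', abs_two]
    exact mul_le_mul_of_nonneg_left (hfg t) (by positivity)
  have hΛS : g1 t * P ≤ Λ * P := mul_le_mul_of_nonneg_right (hg1 t) hPp.le
  have hpos1 : 0 < Λ * Λ * P + Λ * (B * μ) := by positivity
  have hpos2 : 0 < Λ * S := by positivity
  have hpos3 : 0 < Λ * P := by positivity
  refine ⟨?_, ?_, ?_, ?_, ?_⟩
  · have h1 : 8 * Λ ^ 2 * g1 t ≤ 2 * lam * f (g t) + lam ^ 2 * g1 t := by
      have := (abs_le.1 hlf).1
      rw [hlam2]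
      calc 8 * Λ ^ 2 * g1 t = - (2 * μ * (Λ * g1 t)) + μ ^ 2 * g1 t := by rw [hμ]; ring
        _ ≤ _ := by linarith
    have h2 : 0 ≤ 8 * Λ ^ 2 * g1 t := by positivity
    have h3 : corr₂ f V g g1 B lam t - V (g t) * corr g1 B lam t =
        - V (g t) - B * e * (2 * lam * f (g t) + lam ^ 2 * g1 t) := by
      simp only [corr₂]; ring
    rw [h3]
    by_cases htT : T ≤ |t|
    · have := hV t htT
      have : 0 ≤ B * e * (2 * lam * f (g t) + lam ^ 2 * g1 t) := by
        have := h2.trans h1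
        positivity
      linarith
    · push Not at htT
      have h4 := hmT t ⟨(abs_lt.1 htT).1.le, (abs_lt.1 htT).2.le⟩
      have h5 : Real.exp (-(μ * T)) ≤ e := by
        refine Real.exp_le_exp.2 ?_
        have : |lam * t| ≤ μ * T := by
          rw [abs_mul, hlam']; exact mul_le_mul_of_nonneg_left htT.le hμp.le
        linarith [(abs_le.1 this).1]
      have h6 : N ≤ e * (2 * lam * f (g t) + lam ^ 2 * g1 t) := by
        refine mul_le_mul h5 (le_trans ?_ h1) (by positivity) he0.le
        exact mul_le_mul_of_nonneg_left h4 (by positivity)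
      have h7 : L + a ≤ B * e * (2 * lam * f (g t) + lam ^ 2 * g1 t) := by
        calc L + a = B * N := by rw [hB]; field_simp
          _ ≤ _ := by rw [mul_assoc]; exact mul_le_mul_of_nonneg_left h6 hBp.le
      have := (abs_le.1 (hf.abs_le (g t))).1
      linarith
  · have := abs_le.1 (hq1.trans hΛS)
    rw [abs_le]; constructor <;> linarith
  · have h1 : |f (g t) * (B * (1 - e) - k)| ≤ Λ * Λ * P := by
      rw [abs_mul]
      exact mul_le_mul ((hfg t).trans (mul_le_mul_of_nonneg_left (hg1 t) hΛ.le)) hB1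
        (abs_nonneg _) (by positivity)
    have h2 : |g1 t * (B * lam * e)| ≤ Λ * (B * μ) := by
      rw [abs_mul, abs_mul, abs_mul, hlam', abs_of_pos hp, abs_of_pos hBp, abs_of_pos he0]
      exact mul_le_mul (hg1 t) (mul_le_of_le_one_right (by positivity) he1) (by positivity) hΛ.le
    have := abs_sub (f (g t) * (B * (1 - e) - k)) (g1 t * (B * lam * e))
    simp only [corr₁]
    linarith
  · have h1 : |corr₂ f V g g1 B lam t| ≤ g1 t * S := by
      have h2 : |V (g t) * (corr g1 B lam t - 1)| ≤ L * (g1 t * P) := by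
        rw [abs_mul]
        exact mul_le_mul (hf.abs_le _) hq1 (abs_nonneg _) hL.le
      have h3 : |B * e * (2 * lam * f (g t) + lam ^ 2 * g1 t)| ≤
          B * (2 * μ * (Λ * g1 t) + μ ^ 2 * g1 t) := by
        rw [abs_mul, abs_mul, abs_of_pos hBp, abs_of_pos he0]
        refine mul_le_mul (mul_le_of_le_one_right hBp.le he1) ?_ (abs_nonneg _) hBp.le
        refine (abs_add_le _ _).trans (add_le_add hlf ?_)
        rw [hlam2, abs_of_nonneg (by positivity)]
      have := abs_sub (V (g t) * (corr g1 B lam t - 1))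
        (B * e * (2 * lam * f (g t) + lam ^ 2 * g1 t))
      simp only [corr₂]
      calc _ ≤ _ := this
        _ ≤ _ := add_le_add h2 h3
        _ = _ := by rw [hS]; ring
    rw [abs_mul]
    calc |t| * |corr₂ f V g g1 B lam t| ≤ |t| * (g1 t * S) :=
          mul_le_mul_of_nonneg_left h1 (abs_nonneg _)
      _ = |t| * g1 t * S := by ring
      _ ≤ Λ * S := mul_le_mul_of_nonneg_right (htg t) hSp.le
      _ ≤ _ := by linarith
  · intro htT
    have h1 : 2 * (Λ * P) ≤ |t| := (le_max_right _ _).trans htT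
    have h2 : g1 t * P ≤ 1 / 2 := by
      have h3 : 2 * (Λ * P) * g1 t ≤ Λ := (mul_le_mul_of_nonneg_right h1 hp.le).trans (htg t)
      have : Λ * (2 * (g1 t * P)) ≤ Λ * 1 := by linarith
      have := le_of_mul_le_mul_left this hΛ
      linarith
    linarith [(abs_le.1 (hq1.trans h2)).1]

end IsProfile

/-- First-order Taylor estimate for the nonlinearity, uniform in the base point. -/
lemma IsBistable.exists_taylor {f V : ℝ → ℝ} {L : ℝ} (hf : IsBistable f V L) {ω : ℝ}
    (hω : 0 < ω) : ∃ δ > 0, ∀ s h, |h| ≤ δ → |f (s + h) - f s - V s * h| ≤ ω * |h| := by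
  obtain ⟨δ, hδ, hVδ⟩ := Metric.uniformContinuous_iff.1 hf.uniformContinuous ω hω
  refine ⟨δ / 2, half_pos hδ, fun s h hh => ?_⟩
  have hd : ∀ y, HasDerivAt (fun y => f y - V s * y) (V y - V s) y := fun y =>
    ((hf.hasDerivAt y).sub ((hasDerivAt_id y).const_mul (V s))).congr_deriv (by simp)
  have := (convex_closedBall s (δ / 2)).norm_image_sub_le_of_norm_hasDerivWithin_le
    (fun y _ => (hd y).hasDerivWithinAt) (C := ω) (fun y hy => by
      have : dist y s < δ := lt_of_le_of_lt hy (half_lt_self hδ)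
      exact (hVδ this).le) (mem_closedBall_self (half_pos hδ).le)
      (by simpa using hh : s + h ∈ closedBall s (δ / 2))
  simp only [Real.norm_eq_abs, add_sub_cancel_left] at this
  convert this using 2
  ring

namespace IsProfile

variable {f V g g1 : ℝ → ℝ} {L : ℝ}

lemma corr_supersolution {a A Q M ω ρ t m q q₁ q₂ G G₁ F Vg Fψ : ℝ} (hρ : 0 < ρ)
    (ha : 0 < a) (hM : 0 < M) (hA : A = 4 * M / a)
    (hm : 0 ≤ m) (hQ : 0 < Q) (hω : ω = a / (4 * Q)) (hρK : 4 * (2 + m) * Q / a ≤ ρ)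
    (h1 : q₂ - Vg * q ≤ -a) (h2 : |q| ≤ Q) (h3 : |q₁| ≤ Q) (h4 : |t * q₂| ≤ Q)
    (h5 : 2 * (t * F) + m * G₁ ≤ M)
    (h6 : |Fψ - F - Vg * (A / ρ * q)| ≤ ω * |A / ρ * q|) (hG : G = F) :
    (G + A / ρ * q₂) * (1 + 2 * t / ρ) + (G₁ + A / ρ * q₁) * (m / ρ) < Fψ := by
  subst hG
  have hAp : 0 < A := by rw [hA]; positivity
  set s := A / ρ with hs
  have hsp : 0 < s := by positivity
  have e1 : Fψ ≥ G + Vg * (s * q) - s * (a / 4) := by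
    have hh : ω * |s * q| ≤ s * (a / 4) := by
      rw [abs_mul, abs_of_pos hsp, hω]
      calc a / (4 * Q) * (s * |q|) ≤ a / (4 * Q) * (s * Q) := by gcongr
        _ = _ := by field_simp
    linarith [(abs_le.1 h6).1]
  have e2 : (2 * (t * q₂) + m * q₁) / ρ ≤ a / 4 := by
    have : 2 * (t * q₂) + m * q₁ ≤ (2 + m) * Q := by
      have := mul_le_mul_of_nonneg_left (le_of_abs_le h3) hm
      linarith [le_of_abs_le h4]
    rw [div_le_iff₀ ha] at hρK
    rw [div_le_iff₀ hρ]
    linarith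
  have e3 : (2 * (t * G) + m * G₁) / ρ ≤ s * (a / 4) := by
    calc _ ≤ M / ρ := by gcongr
      _ = _ := by rw [hs, hA]; field_simp
  have e4 : (G + s * q₂) * (1 + 2 * t / ρ) + (G₁ + s * q₁) * (m / ρ) =
      G + s * (q₂ - Vg * q) + Vg * (s * q) + (2 * (t * G) + m * G₁) / ρ
        + s * ((2 * (t * q₂) + m * q₁) / ρ) := by
    field_simp; ring
  have e5 := mul_le_mul_of_nonneg_left h1 hsp.le
  have e6 := mul_le_mul_of_nonneg_left e2 hsp.le
  have e7 : 0 < s * a := by positivity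
  rw [e4]
  linarith

/-- Existence of a one-dimensional barrier which, composed with the approximate signed distance
`(|x - c|² - ρ²) / (2ρ)`, is a strict supersolution away from the sphere. -/
theorem exists_barrier (hf : IsBistable f V L) (hg : IsProfile f g g1) (n : ℕ) :
    ∃ (q : ℝ → ℝ) (A Q K T : ℝ), 0 < A ∧ 0 < Q ∧ 0 < K ∧ 0 < T ∧ Continuous q ∧ q 0 = 0 ∧
      (∀ t, |q t| ≤ Q) ∧ (∀ t, T ≤ |t| → 1 / 2 ≤ q t) ∧
      (∀ ρ ≥ K, ∀ t, -1 < g t + A / ρ * q t) ∧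
      ∀ ρ ≥ K, ∀ t₀ ≠ 0, ∃ ψ ψ₁ ψ₂ : ℝ → ℝ, (∀ t, HasDerivAt ψ (ψ₁ t) t) ∧
        (∀ t, HasDerivAt ψ₁ (ψ₂ t) t) ∧ Continuous ψ₂ ∧
        ψ =ᶠ[nhds t₀] (fun t => g t + A / ρ * q t) ∧
        ψ₂ t₀ * (1 + 2 * t₀ / ρ) + ψ₁ t₀ * (n / ρ) < f (ψ t₀) := by
  obtain ⟨B, μ, Q, T, a, hμ, hQ, hT, ha, hcorr⟩ := hg.exists_corr hf
  obtain ⟨-, Λ, -, -, hΛ, -, hfg, -, htg, hg1⟩ := hg.exists_bounds hf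
  set M := 2 * Λ ^ 2 + n * Λ with hM
  have hMp : 0 < M := by positivity
  set A := 4 * M / a with hA
  have hAp : 0 < A := by positivity
  set ω := a / (4 * Q) with hω
  obtain ⟨δ, hδ, htay⟩ := hf.exists_taylor (by positivity : 0 < ω)
  set q : ℝ → ℝ := fun t => corr g1 B (-μ) |t| + (g1 t - g1 |t|) *
    (B * (1 - Real.exp (-μ * |t|)) - 1 / g1 0) with hq
  have hqn : ∀ t ≤ 0, q t = corr g1 B μ t := fun t ht => by
    simp only [hq, corr, abs_of_nonpos ht, neg_mul_neg]; ring
  have hqp : ∀ t, 0 ≤ t → q t = corr g1 B (-μ) t := fun t ht => by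
    simp only [hq, corr, abs_of_nonneg ht]; ring
  have hsign : ∀ t, ∃ lam, (lam = μ ∨ lam = -μ) ∧ lam * t ≤ 0 ∧ q t = corr g1 B lam t ∧
      (t ≠ 0 → q =ᶠ[nhds t] corr g1 B lam) := by
    intro t
    rcases le_total t 0 with h | h
    · refine ⟨μ, Or.inl rfl, mul_nonpos_of_nonneg_of_nonpos hμ.le h, hqn t h, fun h0 => ?_⟩
      filter_upwards [gt_mem_nhds (lt_of_le_of_ne h h0)] with s hs using hqn s hs.le
    · refine ⟨-μ, Or.inr rfl, by nlinarith, hqp t h, fun h0 => ?_⟩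
      filter_upwards [lt_mem_nhds (lt_of_le_of_ne h h0.symm)] with s hs using hqp s hs.le
  have hqQ : ∀ t, |q t| ≤ Q := fun t => by
    obtain ⟨lam, h1, h2, h3, -⟩ := hsign t
    rw [h3]; exact (hcorr lam t h1 h2).2.1
  have hqT : ∀ t, T ≤ |t| → 1 / 2 ≤ q t := fun t => by
    obtain ⟨lam, h1, h2, h3, -⟩ := hsign t
    rw [h3]; exact (hcorr lam t h1 h2).2.2.2.2
  have hgT : 0 < 1 + g (-T) := by linarith [(hg.mem_Ioo (-T)).1]
  refine ⟨q, A, Q, 1 + A * Q / δ + 4 * (2 + n) * Q / a + A * Q / (1 + g (-T)), T, hAp, hQ,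
    by positivity, hT, ?_, ?_, hqQ, hqT, fun ρ hρ t => ?_, fun ρ hρ t₀ ht₀ => ?_⟩
  · have := hg.continuous_deriv
    simp only [hq]
    unfold corr
    fun_prop
  · rw [hqn 0 le_rfl]
    simp [corr, (hg.deriv_pos 0).ne']
  · have p1 : 0 < A * Q / δ := by positivity
    have p2 : 0 < 4 * (2 + n) * Q / a := by positivity
    have p3 : 0 < A * Q / (1 + g (-T)) := by positivity
    have hρ0 : 0 < ρ := by linarith
    by_cases hq0 : 0 ≤ q t
    · have : 0 ≤ A / ρ * q t := by positivity
      linarith [(hg.mem_Ioo t).1]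
    · push Not at hq0
      have ht : |t| < T := by
        by_contra! h
        linarith [hqT t h]
      have h1 : g (-T) < g t := hg.strictMono (abs_lt.1 ht).1
      have h2 : A * Q / ρ < 1 + g (-T) := by
        rw [div_lt_iff₀ hρ0]
        have : A * Q / (1 + g (-T)) < ρ := by linarith
        rw [div_lt_iff₀ hgT] at this
        linarith
      have h3 : - (A * Q / ρ) ≤ A / ρ * q t := by
        have : A / ρ * (-Q) ≤ A / ρ * q t :=
          mul_le_mul_of_nonneg_left (abs_le.1 (hqQ t)).1 (by positivity)
        calc _ = A / ρ * (-Q) := by ring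
          _ ≤ _ := this
      linarith
  · have p1 : 0 < A * Q / δ := by positivity
    have p2 : 0 < 4 * (2 + n) * Q / a := by positivity
    have p3 : 0 < A * Q / (1 + g (-T)) := by positivity
    have hρ0 : 0 < ρ := by linarith
    obtain ⟨lam, h1, h2, -, h3⟩ := hsign t₀
    obtain ⟨c1, c2, c3, c4, -⟩ := hcorr lam t₀ h1 h2
    refine ⟨fun t => g t + A / ρ * corr g1 B lam t, fun t => g1 t + A / ρ * corr₁ f g g1 B lam t,
      fun t => f (g t) + A / ρ * corr₂ f V g g1 B lam t,
      fun t => (hg.hasDerivAt t).add ((hg.hasDerivAt_corr B lam t).const_mul _),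
      fun t => (hg.hasDerivAt_deriv t).add ((hg.hasDerivAt_corr₁ hf B lam t).const_mul _),
      (hf.continuous.comp hg.continuous).add
        (continuous_const.mul (hg.continuous_corr₂ hf B lam)), ?_, ?_⟩
    · filter_upwards [h3 ht₀] with s hs
      rw [hs]
    · refine corr_supersolution (F := f (g t₀)) hρ0 ha hMp hA (Nat.cast_nonneg n) hQ hω
        (by linarith) c1 c2 c3 c4 ?_ ?_ rfl
      · have i1 : t₀ * f (g t₀) ≤ Λ * Λ := by
          calc t₀ * f (g t₀) ≤ |t₀ * f (g t₀)| := le_abs_self _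
            _ = |t₀| * |f (g t₀)| := abs_mul _ _
            _ ≤ |t₀| * (Λ * g1 t₀) := mul_le_mul_of_nonneg_left (hfg _) (abs_nonneg _)
            _ = Λ * (|t₀| * g1 t₀) := by ring
            _ ≤ Λ * Λ := mul_le_mul_of_nonneg_left (htg _) hΛ.le
        have i2 : (n : ℝ) * g1 t₀ ≤ n * Λ := mul_le_mul_of_nonneg_left (hg1 _) (Nat.cast_nonneg n)
        rw [hM]
        linarith
      · refine htay _ _ ?_
        rw [abs_mul, abs_of_pos (by positivity)]
        calc A / ρ * |corr g1 B lam t₀| ≤ A / ρ * Q :=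
              mul_le_mul_of_nonneg_left c2 (by positivity)
          _ ≤ δ := by
            rw [div_mul_eq_mul_div, div_le_iff₀ hρ0]
            have : A * Q / δ < ρ := by linarith
            rw [div_lt_iff₀ hδ] at this
            linarith

end IsProfile

/-! ### Radial barriers and the sliding method -/

section Sliding

variable {n : ℕ}

/-- A smooth approximation of the signed distance to the sphere of center `c` and radius `ρ`. -/
def sdist (c : EuclideanSpace ℝ (Fin n)) (ρ : ℝ) (x : EuclideanSpace ℝ (Fin n)) : ℝ :=
  (‖x - c‖ ^ 2 - ρ ^ 2) / (2 * ρ)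

lemma contDiff_sdist (c : EuclideanSpace ℝ (Fin n)) (ρ : ℝ) : ContDiff ℝ 2 (sdist c ρ) := by
  unfold sdist
  exact (((contDiff_id.sub contDiff_const).norm_sq ℝ).sub contDiff_const).div_const _

lemma lap_comp_sdist {ψ ψ₁ ψ₂ : ℝ → ℝ} (h1 : ∀ t, HasDerivAt ψ (ψ₁ t) t)
    (h2 : ∀ t, HasDerivAt ψ₁ (ψ₂ t) t) (h3 : Continuous ψ₂) (c : EuclideanSpace ℝ (Fin n)) {ρ : ℝ}
    (hρ : 0 < ρ) (x : EuclideanSpace ℝ (Fin n)) :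
    lap n (fun y => ψ (sdist c ρ y)) x =
      ψ₂ (sdist c ρ x) * (1 + 2 * sdist c ρ x / ρ) + ψ₁ (sdist c ρ x) * (n / ρ) := by
  have hline : ∀ (i : Fin n) (t : ℝ), sdist c ρ (x + t • EuclideanSpace.single i (1:ℝ)) =
      sdist c ρ x + (2 * t * (x - c) i + t ^ 2) / (2 * ρ) := by
    intro i t
    have : x + t • EuclideanSpace.single i (1:ℝ) - c =
      (x - c) + t • EuclideanSpace.single i (1:ℝ) := by abel
    rw [sdist, this, norm_add_smul_single_sq, sdist]
    ring
  have hdl : ∀ (i : Fin n) (t : ℝ),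
      HasDerivAt (fun t : ℝ => sdist c ρ (x + t • EuclideanSpace.single i (1:ℝ)))
        (((x - c) i + t) / ρ) t := by
    intro i t
    simp only [hline]
    have e1 := (((hasDerivAt_id t).const_mul 2).mul_const ((x - c) i)).add ((hasDerivAt_id t).pow 2)
    refine ((e1.div_const (2 * ρ)).const_add (sdist c ρ x)).congr_deriv ?_
    simp
    field_simp
  rw [lap_eq_of_line (u := fun y => ψ (sdist c ρ y))
    ((contDiff_two_of_hasDerivAt h1 h2 h3).comp (contDiff_sdist c ρ)) x
    (fun i t => ψ₁ (sdist c ρ (x + t • EuclideanSpace.single i (1:ℝ))) * (((x - c) i + t) / ρ))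
    (fun i => ψ₂ (sdist c ρ x) * ((x - c) i / ρ) ^ 2 + ψ₁ (sdist c ρ x) / ρ)
    (fun i t => (h1 _).comp t (hdl i t))]
  · have hn : ‖x - c‖ ^ 2 = ∑ i, (x - c) i ^ 2 := by
      rw [EuclideanSpace.norm_sq_eq]; simp
    rw [Finset.sum_add_distrib, ← Finset.mul_sum]
    simp only [div_pow, ← Finset.sum_div, ← hn, Finset.sum_const, Finset.card_univ,
      Fintype.card_fin, nsmul_eq_mul]
    have : ‖x - c‖ ^ 2 = 2 * ρ * sdist c ρ x + ρ ^ 2 := by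
      rw [sdist]; field_simp; ring
    rw [this]
    field_simp
    ring
  · intro i
    have e1 := ((h2 _).comp 0 (hdl i 0)).mul
      (((hasDerivAt_id (0 : ℝ)).const_add ((x - c) i)).div_const ρ)
    refine e1.congr_deriv ?_
    simp
    ring

lemma neg_half_le_sdist (c : EuclideanSpace ℝ (Fin n)) {ρ : ℝ} (hρ : 0 < ρ)
    (x : EuclideanSpace ℝ (Fin n)) : -(ρ / 2) ≤ sdist c ρ x := by
  rw [sdist, le_div_iff₀ (by positivity)]
  nlinarith [sq_nonneg ‖x - c‖]

/-- A solution cannot touch a strict supersolution from below. -/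
lemma no_contact {u : EuclideanSpace ℝ (Fin n) → ℝ} {f ψ ψ₁ ψ₂ Ψ : ℝ → ℝ}
    (hu : ContDiff ℝ 2 u)
    (hlap : ∀ x, lap n u x = f (u x)) (h1 : ∀ t, HasDerivAt ψ (ψ₁ t) t)
    (h2 : ∀ t, HasDerivAt ψ₁ (ψ₂ t) t) (h3 : Continuous ψ₂) {c x : EuclideanSpace ℝ (Fin n)} {ρ : ℝ}
    (hρ : 0 < ρ) (heq : ψ =ᶠ[nhds (sdist c ρ x)] Ψ)
    (hlt : ψ₂ (sdist c ρ x) * (1 + 2 * sdist c ρ x / ρ) + ψ₁ (sdist c ρ x) * (n / ρ) <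
      f (ψ (sdist c ρ x))) (hle : ∀ y, u y ≤ Ψ (sdist c ρ y)) (hx : u x = Ψ (sdist c ρ x)) :
    False := by
  have hψ : ContDiff ℝ 2 fun y => ψ (sdist c ρ y) :=
    (contDiff_two_of_hasDerivAt h1 h2 h3).comp (contDiff_sdist c ρ)
  have hm : IsLocalMax (fun y => u y - ψ (sdist c ρ y)) x := by
    have := (contDiff_sdist c ρ).continuous.continuousAt.eventually heq
    filter_upwards [this] with y hy
    rw [hy, heq.eq_of_nhds, hx]
    linarith [hle y]
  have := lap_nonpos_of_isLocalMax (hu.sub hψ) hm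
  rw [lap_sub hu hψ, hlap, lap_comp_sdist h1 h2 h3 c hρ, hx, ← heq.eq_of_nhds] at this
  linarith

variable {f g q : ℝ → ℝ} {A K : ℝ}

/-- The sliding method for a family of radial barriers. -/
lemma le_of_sliding {u : EuclideanSpace ℝ (Fin n) → ℝ} (hu : ContDiff ℝ 2 u)
    (hu1 : ∀ x, u x ≤ 1) (hlap : ∀ x, lap n u x = f (u x)) (hK : 0 < K)
    (hgc : Continuous g) (hqc : Continuous q) (hg0 : g 0 = 0) (hq0 : q 0 = 0)
    (hb : ∀ ρ ≥ K, ∀ t₀ ≠ 0, ∃ ψ ψ₁ ψ₂ : ℝ → ℝ, (∀ t, HasDerivAt ψ (ψ₁ t) t) ∧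
        (∀ t, HasDerivAt ψ₁ (ψ₂ t) t) ∧ Continuous ψ₂ ∧
        ψ =ᶠ[nhds t₀] (fun t => g t + A / ρ * q t) ∧
        ψ₂ t₀ * (1 + 2 * t₀ / ρ) + ψ₁ t₀ * (n / ρ) < f (ψ t₀))
    {c : ℝ → EuclideanSpace ℝ (Fin n)} {r : ℝ → ℝ} (hc : Continuous c) (hr : Continuous r)
    (hrK : ∀ τ, K ≤ r τ)
    (hneg : ∀ τ ∈ Ico (0 : ℝ) 1, ∀ x, sdist (c τ) (r τ) x = 0 → u x < 0)
    (h0 : ∀ x, u x < g (sdist (c 0) (r 0) x) + A / r 0 * q (sdist (c 0) (r 0) x)) {M : ℝ}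
    (hM : ∀ τ ∈ Icc (0 : ℝ) 1, ∀ x, M < ‖x‖ →
      1 < g (sdist (c τ) (r τ) x) + A / r τ * q (sdist (c τ) (r τ) x)) :
    ∀ τ ∈ Ico (0 : ℝ) 1, ∀ x,
      u x ≤ g (sdist (c τ) (r τ) x) + A / r τ * q (sdist (c τ) (r τ) x) := by
  have hr0 : ∀ τ, r τ ≠ 0 := fun τ => (hK.trans_le (hrK τ)).ne'
  have hdc : Continuous fun p : ℝ × EuclideanSpace ℝ (Fin n) => sdist (c p.1) (r p.1) p.2 := by
    unfold sdist
    refine Continuous.div (by fun_prop) (by fun_prop) fun p => ?_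
    exact mul_ne_zero two_ne_zero (hr0 _)
  set Φ : ℝ × EuclideanSpace ℝ (Fin n) → ℝ := fun p =>
    g (sdist (c p.1) (r p.1) p.2) + A / r p.1 * q (sdist (c p.1) (r p.1) p.2) with hΦ
  have hΦc : Continuous Φ :=
    (hgc.comp hdc).add ((continuous_const.div (hr.comp continuous_fst) fun p => hr0 _).mul
      (hqc.comp hdc))
  intro τ hτ x
  by_contra! hlt
  set S : Set (ℝ × EuclideanSpace ℝ (Fin n)) :=
    (Icc 0 τ ×ˢ closedBall 0 M) ∩ {p | Φ p ≤ u p.2} with hS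
  have hScomp : IsCompact S := (isCompact_Icc.prod (isCompact_closedBall _ _)).inter_right
    (isClosed_le hΦc (hu.continuous.comp continuous_snd))
  have hball : ∀ s ∈ Icc (0 : ℝ) τ, ∀ y, Φ (s, y) ≤ u y → (s, y) ∈ S := by
    intro s hs y hy
    refine ⟨⟨hs, ?_⟩, hy⟩
    by_contra! h
    simp only [mem_closedBall, dist_zero_right, not_le] at h
    have h2 := hM s ⟨hs.1, hs.2.trans hτ.2.le⟩ y h
    have h3 := hu1 y
    simp only [hΦ] at hy
    linarith
  obtain ⟨⟨s, y⟩, hsy, hmin⟩ := hScomp.exists_isMinOn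
    ⟨(τ, x), hball τ ⟨hτ.1, le_rfl⟩ x hlt.le⟩ continuous_fst.continuousOn
  have hs := hsy.1.1
  simp only at hs
  have hyle : Φ (s, y) ≤ u y := hsy.2
  have hs0 : 0 < s := by
    rcases hs.1.eq_or_lt with h | h
    · subst h
      have := h0 y
      simp only [hΦ] at hyle
      linarith
    · exact h
  have hle : ∀ z, u z ≤ Φ (s, z) := by
    intro z
    have hcz : Tendsto (fun t => Φ (t, z)) (nhdsWithin s (Iio s)) (nhds (Φ (s, z))) :=
      ((hΦc.comp (by fun_prop : Continuous fun t : ℝ => (t, z))).tendsto s).mono_left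
        nhdsWithin_le_nhds
    refine ge_of_tendsto hcz ?_
    filter_upwards [Ioo_mem_nhdsLT hs0] with t ht
    by_contra! h
    have := hmin (hball t ⟨ht.1.le, ht.2.le.trans hs.2⟩ z h.le)
    simp only [mem_ofPred_eq] at this
    linarith [ht.2]
  have hs1 : s ∈ Ico (0 : ℝ) 1 := ⟨hs.1, hs.2.trans_lt hτ.2⟩
  have heq : u y = Φ (s, y) := le_antisymm (hle y) hyle
  have hd : sdist (c s) (r s) y ≠ 0 := by
    intro h
    have := hneg s hs1 y h
    rw [heq] at this
    simp only [hΦ, h, hg0, hq0] at this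
    simp at this
  obtain ⟨ψ, ψ₁, ψ₂, e1, e2, e3, e4, e5⟩ := hb (r s) (hrK s) _ hd
  exact no_contact hu hlap e1 e2 e3 (hK.trans_le (hrK s)) e4 e5 hle heq

end Sliding

section UpperBound

variable {n : ℕ} {f V g g1 : ℝ → ℝ} {L : ℝ}

lemma exists_forall_one_lt {g q : ℝ → ℝ} (hg : Tendsto g atTop (nhds 1)) {T : ℝ}
    (hq : ∀ t, T ≤ |t| → 1 / 2 ≤ q t) {A : ℝ} (hA : 0 < A) {R : ℝ} (hR : 0 < R) :
    ∃ T' > 0, ∀ t ≥ T', ∀ ρ, 0 < ρ → ρ ≤ R → 1 < g t + A / ρ * q t := by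
  have hpos : 0 < A / R / 2 := by positivity
  obtain ⟨T₁, hT₁⟩ := eventually_atTop.1 (hg.eventually
    (lt_mem_nhds (by linarith : 1 - A / R / 2 < 1)))
  refine ⟨max 1 (max T T₁), by positivity, fun t ht ρ hρ hρR => ?_⟩
  have h1 : 1 ≤ t := (le_max_left _ _).trans ht
  have h2 : T ≤ t := ((le_max_left _ _).trans (le_max_right _ _)).trans ht
  have h3 : T₁ ≤ t := ((le_max_right _ _).trans (le_max_right _ _)).trans ht
  have h4 := hT₁ t h3
  have h5 : 1 / 2 ≤ q t := hq t (h2.trans (le_abs_self t))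
  have h6 : A / R ≤ A / ρ := div_le_div_of_nonneg_left hA.le hρ hρR
  have h7 : A / R * (1 / 2) ≤ A / ρ * q t := mul_le_mul h6 h5 (by norm_num) (by positivity)
  linarith

/-- A solution which is close to `-1` at some point of `B_{R/4}(c)` and is negative in `B_R(c)`
lies below the radial barrier. -/
theorem exists_upper_bound (hf : IsBistable f V L) (hg : IsProfile f g g1) (n : ℕ) :
    ∃ ε > 0, ∃ C > 0, ∃ R₀ > 0, ∀ R ≥ R₀, ∀ u : EuclideanSpace ℝ (Fin n) → ℝ, ContDiff ℝ 2 u →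
      (∀ x, |u x| ≤ 1) → (∀ x, lap n u x = f (u x)) → ∀ c, (∀ x ∈ ball c R, u x < 0) →
      ∀ x₀ ∈ ball c (R / 4), u x₀ ≤ -1 + ε → ∀ x, u x ≤ g (sdist c R x) + C / R := by
  obtain ⟨q, A, Q, K, T, hA, hQ, hK, hT, hqc, hq0, hqQ, hqT, hgt, hb⟩ := hg.exists_barrier hf n
  obtain ⟨T', hT', hbig⟩ := exists_forall_one_lt hg.tendsto_atTop hqT hA hK
  obtain ⟨CH, hCH, hH⟩ := harnack n L (ρ := K + T' + 1) (by positivity)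
  have hgc := hg.continuous
  obtain ⟨η, hη, hηt⟩ : ∃ η > 0, ∀ t ∈ Icc (-(K / 2)) T', η ≤ 1 + (g t + A / K * q t) := by
    have hcont : Continuous fun t => 1 + (g t + A / K * q t) := by fun_prop
    obtain ⟨s, -, hs⟩ := (isCompact_Icc (a := -(K / 2)) (b := T')).exists_isMinOn
      ⟨0, by constructor <;> linarith⟩ hcont.continuousOn
    exact ⟨_, by linarith [hgt K le_rfl s], fun t ht => hs ht⟩
  refine ⟨η / (2 * CH), by positivity, A * Q, by positivity, 2 * K, by positivity, ?_⟩
  intro R hR u hu hu1 hlap c hneg x₀ hx₀ hux₀ x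
  have hR0 : 0 < R := by linarith
  have hu1' : ∀ x, u x ≤ 1 := fun x => le_of_abs_le (hu1 x)
  set γ : ℝ → EuclideanSpace ℝ (Fin n) := fun τ => (1 - τ) • x₀ + τ • c with hγ
  set r : ℝ → ℝ := fun τ => K + |τ| * (R - K) with hr
  have hrK : ∀ τ, K ≤ r τ := fun τ => by
    have : 0 ≤ |τ| * (R - K) := mul_nonneg (abs_nonneg _) (by linarith)
    simp only [hr]; linarith
  have hr0 : r 0 = K := by simp [hr]
  have hr1 : r 1 = R := by simp [hr]
  have hγ0 : γ 0 = x₀ := by simp [hγ]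
  have hγ1 : γ 1 = c := by simp [hγ]
  have hγc : Continuous γ := by fun_prop
  have hrc : Continuous r := by fun_prop
  have hd0 : dist x₀ c < R / 4 := hx₀
  have hlt0 : ∀ y, u y < g (sdist (γ 0) (r 0) y) + A / r 0 * q (sdist (γ 0) (r 0) y) := by
    intro y
    rw [hr0, hγ0]
    by_cases hy : T' ≤ sdist x₀ K y
    · exact (hu1' y).trans_lt (hbig _ hy K hK le_rfl)
    push Not at hy
    have hmem := hηt _ ⟨neg_half_le_sdist x₀ hK y, hy.le⟩
    have hyb : y ∈ ball x₀ (K + T' + 1) := by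
      rw [sdist, div_lt_iff₀ (by positivity)] at hy
      rw [mem_ball, dist_eq_norm]
      refine lt_of_pow_lt_pow_left₀ 2 (by positivity) ?_
      nlinarith
    have hv : ContDiff ℝ 2 fun y => u y + 1 := hu.add contDiff_const
    have h1 := hH (fun y => u y + 1) x₀ hv (fun y _ => by linarith [(abs_le.1 (hu1 y)).1])
      (fun y _ => by
        rw [lap_add hu contDiff_const, lap_const, add_zero, hlap]
        have := hf.abs_sub_le (u y) (-1)
        rwa [hf.zero_left, sub_zero, sub_neg_eq_add,
          abs_of_nonneg (a := u y + 1) (by linarith [(abs_le.1 (hu1 y)).1])] at this) y hyb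
    have h2 : CH * (u x₀ + 1) ≤ η / 2 := by
      calc CH * (u x₀ + 1) ≤ CH * (η / (2 * CH)) := by gcongr; linarith
        _ = η / 2 := by field_simp
    linarith
  have hnegτ : ∀ τ ∈ Ico (0 : ℝ) 1, ∀ y, sdist (γ τ) (r τ) y = 0 → u y < 0 := by
    intro τ hτ y hy
    refine hneg y ?_
    have hrp : 0 < r τ := hK.trans_le (hrK τ)
    rw [sdist, div_eq_zero_iff] at hy
    have h1 : ‖y - γ τ‖ = r τ := by
      rcases hy with h | h
      · exact (sq_eq_sq₀ (norm_nonneg _) hrp.le).1 (by linarith)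
      · linarith
    have h2 : dist (γ τ) c = (1 - τ) * dist x₀ c := by
      rw [dist_eq_norm, dist_eq_norm, ← Real.norm_of_nonneg (by linarith [hτ.2] : 0 ≤ 1 - τ),
        ← norm_smul]
      congr 1
      simp only [hγ]
      module
    have h3 := dist_triangle y (γ τ) c
    rw [dist_eq_norm y (γ τ), h1, h2] at h3
    rw [mem_ball]
    simp only [hr, abs_of_nonneg hτ.1] at h3
    have h4 : 0 < 1 - τ := by linarith [hτ.2]
    nlinarith
  obtain ⟨TR, hTR, hbigR⟩ := exists_forall_one_lt hg.tendsto_atTop hqT hA hR0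
  have hfar : ∀ τ ∈ Icc (0 : ℝ) 1, ∀ y, ‖x₀‖ + ‖c‖ + R + TR * 2 < ‖y‖ →
      1 < g (sdist (γ τ) (r τ) y) + A / r τ * q (sdist (γ τ) (r τ) y) := by
    intro τ hτ y hy
    have hrp : 0 < r τ := hK.trans_le (hrK τ)
    have hrR : r τ ≤ R := by
      simp only [hr, abs_of_nonneg hτ.1]
      nlinarith [hτ.2]
    refine hbigR _ ?_ _ hrp hrR
    have h1 : ‖γ τ‖ ≤ ‖x₀‖ + ‖c‖ := by
      refine (norm_add_le _ _).trans ?_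
      rw [norm_smul, norm_smul, Real.norm_of_nonneg hτ.1,
        Real.norm_of_nonneg (by linarith [hτ.2] : 0 ≤ 1 - τ)]
      have := norm_nonneg x₀
      have := norm_nonneg c
      nlinarith [hτ.1, hτ.2]
    have h2 := norm_sub_norm_le y (γ τ)
    have h3 : R + TR * 2 ≤ ‖y - γ τ‖ := by linarith
    rw [ge_iff_le, sdist, le_div_iff₀ (by positivity)]
    have h4 : r τ + TR * 2 ≤ ‖y - γ τ‖ := by linarith
    have h5 : (r τ + TR * 2) ^ 2 ≤ ‖y - γ τ‖ ^ 2 := pow_le_pow_left₀ (by positivity) h4 2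
    nlinarith [mul_pos hTR hrp]
  have hmain := le_of_sliding hu hu1' hlap hK hgc hqc hg.zero hq0 hb hγc hrc hrK hnegτ hlt0 hfar
  have hcont : Continuous fun τ =>
      g (sdist (γ τ) (r τ) x) + A / r τ * q (sdist (γ τ) (r τ) x) := by
    have hr0 : ∀ τ, r τ ≠ 0 := fun τ => (hK.trans_le (hrK τ)).ne'
    have hdc : Continuous fun τ => sdist (γ τ) (r τ) x := by
      unfold sdist
      refine Continuous.div (by fun_prop) (by fun_prop) fun p => ?_
      exact mul_ne_zero two_ne_zero (hr0 _)
    exact (hgc.comp hdc).add ((continuous_const.div hrc hr0).mul (hqc.comp hdc))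
  have hfin : u x ≤ g (sdist c R x) + A / R * q (sdist c R x) := by
    have := (hcont.tendsto 1).mono_left (nhdsWithin_le_nhds (s := Iio 1))
    simp only [hr1, hγ1] at this
    refine ge_of_tendsto this ?_
    filter_upwards [Ico_mem_nhdsLT (zero_lt_one' ℝ)] with τ hτ using hmain τ hτ x
  have : A / R * q (sdist c R x) ≤ A / R * Q :=
    mul_le_mul_of_nonneg_left (le_of_abs_le (hqQ _)) (by positivity)
  calc u x ≤ _ := hfin
    _ ≤ g (sdist c R x) + A / R * Q := by linarith
    _ = _ := by ring

end UpperBound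

/-! ### Interior estimates for the deviation from the one-dimensional profile -/

section Interior

variable {n : ℕ} {f V g g1 : ℝ → ℝ} {L : ℝ}

lemma IsProfile.contDiff_comp_coord (hf : IsBistable f V L) (hg : IsProfile f g g1) (i₀ : Fin n) :
    ContDiff ℝ 2 fun x : EuclideanSpace ℝ (Fin n) => g (x i₀) :=
  (contDiff_two_of_hasDerivAt hg.hasDerivAt hg.hasDerivAt_deriv
    (hf.continuous.comp hg.continuous)).comp (contDiff_piLp_apply 2)

lemma IsProfile.hasDerivAt_comp_coord (hg : IsProfile f g g1) (i₀ i : Fin n)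
    (x : EuclideanSpace ℝ (Fin n)) (t : ℝ) :
    HasDerivAt (fun t : ℝ => g ((x + t • EuclideanSpace.single i (1:ℝ)) i₀))
      (g1 ((x + t • EuclideanSpace.single i (1:ℝ)) i₀) * (if i₀ = i then 1 else 0)) t := by
  simp only [add_smul_single_apply]
  have h1 : HasDerivAt (fun t : ℝ => x i₀ + t * (if i₀ = i then 1 else 0))
      (if i₀ = i then 1 else 0) t :=
    (((hasDerivAt_id t).mul_const (if i₀ = i then (1:ℝ) else 0)).const_add (x i₀)).congr_deriv
      (by simp)
  exact (hg.hasDerivAt _).comp t h1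

lemma IsProfile.fderiv_comp_coord (hf : IsBistable f V L) (hg : IsProfile f g g1) (i₀ i : Fin n)
    (x : EuclideanSpace ℝ (Fin n)) :
    fderiv ℝ (fun x : EuclideanSpace ℝ (Fin n) => g (x i₀)) x (EuclideanSpace.single i 1) =
      if i₀ = i then g1 (x i₀) else 0 := by
  have h1 := hg.hasDerivAt_comp_coord i₀ i x 0
  have h2 := hasDerivAt_line ((hg.contDiff_comp_coord hf i₀).differentiable (by norm_num)) x
    (EuclideanSpace.single i 1) 0
  have := h2.unique h1
  simpa using this

lemma IsProfile.lap_comp_coord (hf : IsBistable f V L) (hg : IsProfile f g g1) (i₀ : Fin n)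
    (x : EuclideanSpace ℝ (Fin n)) :
    lap n (fun x : EuclideanSpace ℝ (Fin n) => g (x i₀)) x = f (g (x i₀)) := by
  rw [lap_eq_of_line (hg.contDiff_comp_coord hf i₀) x _
    (fun i => if i₀ = i then f (g (x i₀)) else 0)
    (fun i t => hg.hasDerivAt_comp_coord i₀ i x t)]
  · simp
  · intro i
    have h1 : HasDerivAt (fun t : ℝ => x i₀ + t * (if i₀ = i then 1 else 0))
        (if i₀ = i then 1 else 0) 0 :=
      (((hasDerivAt_id (0 : ℝ)).mul_const (if i₀ = i then (1:ℝ) else 0)).const_add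
        (x i₀)).congr_deriv (by simp)
    simp only [add_smul_single_apply]
    have := ((hg.hasDerivAt_deriv _).comp 0 h1).mul_const (if i₀ = i then (1:ℝ) else 0)
    refine this.congr_deriv ?_
    split_ifs <;> simp

/-- One-sided closeness to the profile, improved to two-sided closeness by Harnack's
inequality. -/
lemma exists_abs_sub_le (hf : IsBistable f V L) (hg : IsProfile f g g1) (n : ℕ) (i₀ : Fin n) :
    ∃ ε > 0, ∃ C > 0, ∃ R₀ > 0, ∀ R ≥ R₀, ∀ u : EuclideanSpace ℝ (Fin n) → ℝ, ContDiff ℝ 2 u →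
      (∀ x, |u x| ≤ 1) → (∀ x, lap n u x = f (u x)) →
      (∀ x ∈ ball (-(R • EuclideanSpace.single i₀ (1:ℝ))) R, u x < 0) → u 0 = 0 →
      ∀ x₀ ∈ ball (-(R • EuclideanSpace.single i₀ (1:ℝ))) (R / 4), u x₀ ≤ -1 + ε →
      ∀ x ∈ ball (0 : EuclideanSpace ℝ (Fin n)) 16, |u x - g (x i₀)| ≤ C / R := by
  obtain ⟨ε, hε, C, hC, R₀, hR₀, hub⟩ := exists_upper_bound hf hg n
  obtain ⟨-, Λ, -, -, hΛ, -, -, -, -, hg1⟩ := hg.exists_bounds hf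
  obtain ⟨CH, hCH, hH⟩ := harnack n L (ρ := 16) (by norm_num)
  set C₁ := C + Λ * 2048 with hC₁
  have hC₁p : 0 < C₁ := by positivity
  refine ⟨ε, hε, C₁ + CH * (2 * C₁), by positivity, R₀, hR₀, ?_⟩
  intro R hR u hu hu1 hlap hneg hu0 x₀ hx₀ hux₀ x hx
  have hR0 : 0 < R := by linarith
  have hglip : ∀ a b, a ≤ b → g b - g a ≤ Λ * (b - a) := fun a b hab =>
    image_sub_le_mul_sub_of_deriv_le (fun t => (hg.hasDerivAt t).differentiableAt)
      (fun t => by rw [(hg.hasDerivAt t).deriv]; exact hg1 t) hab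
  have hupper : ∀ y ∈ ball (0 : EuclideanSpace ℝ (Fin n)) 64, u y ≤ g (y i₀) + C₁ / R := by
    intro y hy
    have h1 := hub R hR u hu hu1 hlap _ hneg x₀ hx₀ hux₀ y
    have h2 : sdist (-(R • EuclideanSpace.single i₀ (1:ℝ))) R y = y i₀ + ‖y‖ ^ 2 / (2 * R) := by
      rw [sdist, sub_neg_eq_add, norm_add_smul_single_sq]
      field_simp
      ring
    have h3 : ‖y‖ ^ 2 ≤ 4096 := by
      rw [mem_ball_zero_iff] at hy
      nlinarith [norm_nonneg y]
    have h4 : ‖y‖ ^ 2 / (2 * R) ≤ 2048 / R := by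
      rw [div_le_div_iff₀ (by positivity) hR0]
      nlinarith
    have h5 := hglip (y i₀) (y i₀ + ‖y‖ ^ 2 / (2 * R)) (by linarith [(by positivity :
      0 ≤ ‖y‖ ^ 2 / (2 * R))])
    rw [h2] at h1
    have h6 : Λ * (‖y‖ ^ 2 / (2 * R)) ≤ Λ * (2048 / R) := mul_le_mul_of_nonneg_left h4 hΛ.le
    have h7 : C₁ / R = C / R + Λ * (2048 / R) := by rw [hC₁]; ring
    rw [add_sub_cancel_left] at h5
    linarith
  have hG := hg.contDiff_comp_coord hf i₀
  have hCR : 0 < C₁ / R := by positivity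
  have hw : ContDiff ℝ 2 fun y : EuclideanSpace ℝ (Fin n) => g (y i₀) - u y := hG.sub hu
  have h1 := hH (fun y => (g (y i₀) - u y) + 2 * C₁ / R) 0 (hw.add contDiff_const)
    (fun y hy => by
      have := hupper y (by norm_num at hy ⊢; exact hy)
      have e : 2 * C₁ / R = C₁ / R + C₁ / R := by ring
      rw [e]; linarith)
    (fun y hy => by
      have h2 := hupper y (by norm_num at hy ⊢; exact hy)
      have e : 2 * C₁ / R = C₁ / R + C₁ / R := by ring
      rw [lap_add hw contDiff_const, lap_const, add_zero, lap_sub hG hu, hg.lap_comp_coord hf, hlap]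
      refine (hf.abs_sub_le _ _).trans (mul_le_mul_of_nonneg_left ?_ hf.pos.le)
      rw [e, abs_le]
      constructor <;> linarith) x hx
  have h2 := hupper x (by norm_num at hx ⊢; linarith)
  have e1 : (C₁ + CH * (2 * C₁)) / R = C₁ / R + CH * (2 * C₁ / R) := by ring
  have e2 : 0 < 2 * C₁ / R := by positivity
  have e3 : 0 < CH * (2 * C₁ / R) := by positivity
  simp only [PiLp.zero_apply, hg.zero, hu0, sub_zero, zero_add] at h1
  rw [e1, abs_le]
  constructor <;> linarith

/-- Second derivatives of a solution are controlled by a bound on a first derivative. -/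
lemma abs_fderiv_fderiv_le (hf : IsBistable f V L) {u : EuclideanSpace ℝ (Fin n) → ℝ}
    (hu : ContDiff ℝ 2 u) (hlap : ∀ x, lap n u x = f (u x)) (i j : Fin n) {M : ℝ} (hM : 0 < M)
    {x₀ : EuclideanSpace ℝ (Fin n)}
    (hb : ∀ x ∈ closedBall x₀ 3, |fderiv ℝ u x (EuclideanSpace.single i 1)| ≤ M) :
    |fderiv ℝ (fderiv ℝ u) x₀ (EuclideanSpace.single i 1) (EuclideanSpace.single j 1)| ≤
      (n + L) * M := by
  set a : EuclideanSpace ℝ (Fin n) := EuclideanSpace.single i 1 with ha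
  have hna : ‖a‖ = 1 := by simp [ha]
  have hL := hf.pos
  have hd := hu.differentiable (by norm_num)
  have hus : ∀ s : ℝ, ContDiff ℝ 2 fun x => u (x + s • a) :=
    fun s => hu.comp (contDiff_id.add contDiff_const)
  have hslope : ∀ s : ℝ, 0 < s → s ≤ 1 → ∀ x ∈ closedBall x₀ 2,
      |s⁻¹ * (u (x + s • a) - u x)| ≤ M := by
    intro s hs hs1 x hx
    have := (convex_Icc (0:ℝ) s).norm_image_sub_le_of_norm_hasDerivWithin_le
      (f := fun t : ℝ => u (x + t • a)) (C := M)
      (fun t _ => (hasDerivAt_line hd x a t).hasDerivWithinAt)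
      (fun t ht => hb _ (by
        rw [mem_closedBall, dist_eq_norm] at hx ⊢
        have h1 : ‖t • a‖ ≤ 1 := by
          rw [norm_smul, hna, mul_one, Real.norm_of_nonneg ht.1]; exact ht.2.trans hs1
        have h2 := norm_add_le (x - x₀) (t • a)
        rw [show x + t • a - x₀ = x - x₀ + t • a by abel]
        linarith)) (left_mem_Icc.2 hs.le) (right_mem_Icc.2 hs.le)
    simp only [zero_smul, add_zero, sub_zero, Real.norm_eq_abs, abs_of_pos hs] at this
    rw [abs_mul, abs_of_pos (inv_pos.2 hs), inv_mul_le_iff₀ hs]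
    linarith
  have hquot : ∀ s : ℝ, 0 < s → s ≤ 1 →
      |s⁻¹ * (fderiv ℝ u (x₀ + s • a) (EuclideanSpace.single j 1) -
        fderiv ℝ u x₀ (EuclideanSpace.single j 1))| ≤ (n + L) * M := by
    intro s hs hs1
    have hv : ContDiff ℝ 2 fun x => u (x + s • a) - u x := (hus s).sub hu
    have h1 := abs_partial_deriv_le_of_bounds (u := fun x => s⁻¹ * (u (x + s • a) - u x))
      (contDiff_const.mul hv) j (M := M) (N := 2 * (L * M)) (x₀ := x₀) (hslope s hs hs1)
      (fun x hx => by
        rw [lap_const_mul hv, lap_sub (hus s) hu, lap_comp_add hu, hlap, hlap, abs_mul,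
          abs_of_pos (inv_pos.2 hs)]
        have h2 := hf.abs_sub_le (u (x + s • a)) (u x)
        have h3 := hslope s hs hs1 x hx
        rw [abs_mul, abs_of_pos (inv_pos.2 hs)] at h3
        have h4 := mul_le_mul_of_nonneg_left h2 (inv_pos.2 hs).le
        have h5 := mul_le_mul_of_nonneg_left h3 hL.le
        have h6 : 0 < L * M := by positivity
        linarith)
    have h2 : fderiv ℝ (fun x => s⁻¹ * (u (x + s • a) - u x)) x₀ (EuclideanSpace.single j 1) =
        s⁻¹ * (fderiv ℝ u (x₀ + s • a) (EuclideanSpace.single j 1) -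
          fderiv ℝ u x₀ (EuclideanSpace.single j 1)) := by
      rw [fderiv_const_mul (hv.differentiable (by norm_num) x₀),
        fderiv_fun_sub ((hus s).differentiable (by norm_num) x₀) (hd x₀),
        fderiv_comp_add_right]
      simp
    rw [h2] at h1
    linarith
  have hlim := (hasDerivAt_line (differentiable_fderiv_apply hu (EuclideanSpace.single j 1))
    x₀ a 0).tendsto_slope_zero_right
  simp only [zero_add, zero_smul, add_zero, smul_eq_mul] at hlim
  rw [fderiv_fderiv_apply hu] at hlim
  refine le_of_tendsto hlim.abs ?_
  filter_upwards [Ioc_mem_nhdsGT (zero_lt_one' ℝ)] with s hs using hquot s hs.1 hs.2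

end Interior

/-! ### Level sets as graphs -/

section Graph

variable {E : Type*} [NormedAddCommGroup E] [NormedSpace ℝ E]

/-- Quantitative hypotheses under which `{u = 0}` is a flat graph in the direction `e`
over the range of `P`. -/
structure IsNearlyFlat (u : E → ℝ) (P : E →L[ℝ] E) (e : E) (m M κ : ℝ) : Prop where
  contDiff : ContDiff ℝ 2 u
  norm_le : ∀ z, ‖P z‖ ≤ ‖z‖
  norm_eq : ‖e‖ = 1
  pos : 0 < m
  le : κ ≤ m
  le_deriv : ∀ x ∈ ball (0 : E) 8, m ≤ fderiv ℝ u x e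
  abs_le : ∀ z ∈ ball (0 : E) 8, |u (P z)| ≤ κ
  abs_deriv_le : ∀ x ∈ ball (0 : E) 8, ∀ v, |fderiv ℝ u x (P v)| ≤ κ * ‖v‖
  abs_deriv2_le : ∀ x ∈ ball (0 : E) 8, ∀ w v,
    |fderiv ℝ (fderiv ℝ u) x w (P v)| ≤ κ * ‖w‖ * ‖v‖
  norm_deriv2_le : ∀ x ∈ ball (0 : E) 8, ‖fderiv ℝ (fderiv ℝ u) x‖ ≤ M

variable {u : E → ℝ} {P : E →L[ℝ] E} {e : E} {m M κ : ℝ}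

namespace IsNearlyFlat

lemma nonneg (H : IsNearlyFlat u P e m M κ) : 0 ≤ κ :=
  (abs_nonneg _).trans (H.abs_le 0 (by simp))

lemma mem_ball (H : IsNearlyFlat u P e m M κ) {z : E} (hz : z ∈ ball (0 : E) 5) {t : ℝ}
    (ht : t ∈ Icc (-2 : ℝ) 2) : P z + t • e ∈ ball (0 : E) 8 := by
  rw [mem_ball_zero_iff] at hz ⊢
  have h1 := norm_add_le (P z) (t • e)
  have h2 : ‖t • e‖ ≤ 2 := by
    rw [norm_smul, H.norm_eq, mul_one, Real.norm_eq_abs, _root_.abs_le]; exact ht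
  linarith [H.norm_le z]

lemma mul_sub_le (H : IsNearlyFlat u P e m M κ) {z : E} (hz : z ∈ ball (0 : E) 5) {s t : ℝ}
    (hs : s ∈ Icc (-2 : ℝ) 2) (ht : t ∈ Icc (-2 : ℝ) 2) (hst : s ≤ t) :
    m * (t - s) ≤ u (P z + t • e) - u (P z + s • e) := by
  have hd := hasDerivAt_line (H.contDiff.differentiable (by norm_num)) (P z) e
  refine (convex_Icc (-2 : ℝ) 2).mul_sub_le_image_sub_of_le_deriv
    (f := fun t => u (P z + t • e))
    (fun t _ => (hd t).continuousAt.continuousWithinAt)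
    (fun t _ => (hd t).differentiableAt.differentiableWithinAt) ?_ s hs t ht hst
  intro t ht
  rw [(hd t).deriv]
  exact H.le_deriv _ (H.mem_ball hz (interior_subset ht))

lemma exists_graph (H : IsNearlyFlat u P e m M κ) : ∃ h : E → ℝ, ∀ z ∈ ball (0 : E) 5,
    |h z| ≤ κ / m ∧ u (P z + h z • e) = 0 ∧
      ∀ t ∈ Icc (-2 : ℝ) 2, u (P z + t • e) = 0 → t = h z := by
  have key : ∀ z : E, ∃ a : ℝ, z ∈ ball (0 : E) 5 → |a| ≤ κ / m ∧ u (P z + a • e) = 0 ∧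
      ∀ t ∈ Icc (-2 : ℝ) 2, u (P z + t • e) = 0 → t = a := by
    intro z
    by_cases hz : z ∈ ball (0 : E) 5
    · have hm := H.pos
      have hκ := H.nonneg
      have h0 := _root_.abs_le.1 (H.abs_le z (ball_subset_ball (by norm_num) hz))
      have hκm : κ / m ≤ 1 := (div_le_one hm).2 H.le
      have hκm0 : 0 ≤ κ / m := by positivity
      have e1 : m * (κ / m) = κ := by field_simp
      have hc : Continuous fun t : ℝ => u (P z + t • e) :=
        H.contDiff.continuous.comp (by fun_prop)
      have hp := H.mul_sub_le hz (s := 0) (t := κ / m) ⟨by norm_num, by norm_num⟩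
        ⟨by linarith, by linarith⟩ hκm0
      have hn := H.mul_sub_le hz (s := -(κ / m)) (t := 0) ⟨by linarith, by linarith⟩
        ⟨by norm_num, by norm_num⟩ (by linarith)
      simp only [zero_smul, add_zero, sub_zero, zero_sub, neg_neg] at hp hn
      obtain ⟨a, ha, ha0⟩ := intermediate_value_Icc (by linarith : -(κ / m) ≤ κ / m)
        hc.continuousOn (show (0 : ℝ) ∈ _ from ⟨by linarith, by linarith⟩)
      simp only at ha0
      refine ⟨a, fun _ => ⟨_root_.abs_le.2 ha, ha0, fun t ht ht0 => ?_⟩⟩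
      have ha2 : a ∈ Icc (-2 : ℝ) 2 := ⟨by linarith [ha.1], by linarith [ha.2]⟩
      rcases le_total t a with hta | hta
      · have := H.mul_sub_le hz ht ha2 hta
        rw [ht0, ha0] at this
        nlinarith
      · have := H.mul_sub_le hz ha2 ht hta
        rw [ht0, ha0] at this
        nlinarith
    · exact ⟨0, fun h => absurd h hz⟩
  exact ⟨fun z => (key z).choose, fun z => (key z).choose_spec⟩

variable [CompleteSpace E] {h : E → ℝ}

lemma contDiffAt_graph (H : IsNearlyFlat u P e m M κ)
    (hh : ∀ z ∈ ball (0 : E) 5, |h z| ≤ κ / m ∧ u (P z + h z • e) = 0 ∧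
      ∀ t ∈ Icc (-2 : ℝ) 2, u (P z + t • e) = 0 → t = h z) {z : E} (hz : z ∈ ball (0 : E) 5) :
    ContDiffAt ℝ 2 h z := by
  have hκm : κ / m ≤ 1 := (div_le_one H.pos).2 H.le
  have hY : ContDiff ℝ 2 fun p : E × ℝ => P p.1 + p.2 • e := by fun_prop
  have hF : ContDiff ℝ 2 fun p : E × ℝ => u (P p.1 + p.2 • e) := H.contDiff.comp hY
  have hFz := hF.contDiffAt (x := (z, h z))
  obtain ⟨hz1, hz2, hz3⟩ := hh z hz
  have hz1' := _root_.abs_le.1 hz1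
  have hpos : 0 < fderiv ℝ u (P z + h z • e) e := lt_of_lt_of_le H.pos
    (H.le_deriv _ (H.mem_ball hz ⟨by linarith, by linarith⟩))
  have hline : (fderiv ℝ (fun p : E × ℝ => u (P p.1 + p.2 • e)) (z, h z) ∘L .inr ℝ E ℝ) 1 =
      fderiv ℝ u (P z + h z • e) e := by
    have h1 := hasDerivAt_line (hF.differentiable (by norm_num)) (z, h z) ((0, 1) : E × ℝ) 0
    have h2 := (hasDerivAt_line (H.contDiff.differentiable (by norm_num)) (P z + h z • e) e 0)
    simp only [zero_smul, add_zero] at h1 h2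
    have h3 := h1.congr_of_eventuallyEq (f₁ := fun t : ℝ => u (P z + h z • e + t • e))
      (Eventually.of_forall fun t => by simp [add_smul, add_assoc])
    simpa using h3.unique h2
  have hinv : (fderiv ℝ (fun p : E × ℝ => u (P p.1 + p.2 • e)) (z, h z) ∘L
      .inr ℝ E ℝ).IsInvertible := by
    refine ⟨ContinuousLinearEquiv.unitsEquivAut ℝ (Units.mk0 _ hpos.ne'), ?_⟩
    ext
    rw [hline]
    simp
  have hψ := hFz.contDiffAt_implicitFunction (by norm_num) hinv
  have hψ0 := hFz.implicitFunction_apply_self (by norm_num) hinv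
  have hψe := hFz.eventually_apply_implicitFunction (by norm_num) hinv
  set ψ := hFz.implicitFunction (by norm_num) hinv
  simp only at hψ hψ0 hψe
  refine hψ.congr_of_eventuallyEq ?_
  have hnear : ∀ᶠ y in nhds z, ψ y ∈ Ioo (-2 : ℝ) 2 :=
    hψ.continuousAt.eventually (isOpen_Ioo.mem_nhds (by
      rw [hψ0]; exact ⟨by linarith, by linarith⟩))
  filter_upwards [hψe, hnear, isOpen_ball.mem_nhds hz] with y h1 h2 h3
  exact ((hh y h3).2.2 _ (Ioo_subset_Icc_self h2) (h1.trans hz2)).symm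

lemma abs_deriv_graph_le (H : IsNearlyFlat u P e m M κ)
    (hh : ∀ z ∈ ball (0 : E) 5, |h z| ≤ κ / m ∧ u (P z + h z • e) = 0 ∧
      ∀ t ∈ Icc (-2 : ℝ) 2, u (P z + t • e) = 0 → t = h z) {z : E} (hz : z ∈ ball (0 : E) 5) :
    ‖fderiv ℝ h z‖ ≤ κ / m ∧ ‖fderiv ℝ (fderiv ℝ h) z‖ ≤ 2 * κ * (1 + M / m) / m := by
  have hm := H.pos
  have hκ := H.nonneg
  have hκm : κ / m ≤ 1 := (div_le_one H.pos).2 H.le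
  have hC := fun y (hy : y ∈ ball (0 : E) 5) => H.contDiffAt_graph hh hy
  have hmem : ∀ y ∈ ball (0 : E) 5, P y + h y • e ∈ ball (0 : E) 8 := fun y hy => by
    have := _root_.abs_le.1 (hh y hy).1
    exact H.mem_ball hy ⟨by linarith, by linarith⟩
  have hY : ∀ y ∈ ball (0 : E) 5, HasFDerivAt (fun y => P y + h y • e)
      (P + (fderiv ℝ h y).smulRight e) y := fun y hy =>
    P.hasFDerivAt.add (((hC y hy).differentiableAt (by norm_num)).hasFDerivAt.smul_const e)
  have hud := H.contDiff.differentiable (by norm_num)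
  have hid : ∀ y ∈ ball (0 : E) 5, ∀ v, fderiv ℝ u (P y + h y • e) (P v) +
      fderiv ℝ h y v * fderiv ℝ u (P y + h y • e) e = 0 := by
    intro y hy v
    have h1 := (hud (P y + h y • e)).hasFDerivAt.comp y (hY y hy)
    have h2 : HasFDerivAt (fun y => u (P y + h y • e)) (0 : E →L[ℝ] ℝ) y :=
      (hasFDerivAt_const (0 : ℝ) y).congr_of_eventuallyEq (by
        filter_upwards [isOpen_ball.mem_nhds hy] with x hx using (hh x hx).2.1)
    have h3 := congrArg (fun T : E →L[ℝ] ℝ => T v) (h1.unique h2)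
    simpa using h3
  have hD1 : ∀ y ∈ ball (0 : E) 5, ∀ v, |fderiv ℝ h y v| ≤ κ / m * ‖v‖ := by
    intro y hy v
    have h1 := H.abs_deriv_le _ (hmem y hy) v
    have h2 := H.le_deriv _ (hmem y hy)
    have h3 : fderiv ℝ h y v * fderiv ℝ u (P y + h y • e) e =
      -fderiv ℝ u (P y + h y • e) (P v) := by linarith [hid y hy v]
    have h4 : |fderiv ℝ h y v| * m ≤ κ * ‖v‖ := by
      calc _ ≤ |fderiv ℝ h y v| * fderiv ℝ u (P y + h y • e) e :=
            mul_le_mul_of_nonneg_left h2 (abs_nonneg _)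
        _ = |fderiv ℝ h y v * fderiv ℝ u (P y + h y • e) e| := by
            rw [abs_mul, abs_of_pos (hm.trans_le h2)]
        _ ≤ _ := by rw [h3, abs_neg]; exact h1
    rw [div_mul_eq_mul_div, le_div_iff₀ hm]
    exact h4
  refine ⟨ContinuousLinearMap.opNorm_le_bound _ (by positivity) (hD1 z hz), ?_⟩
  have hM0 : 0 ≤ M :=
    (norm_nonneg (fderiv ℝ (fderiv ℝ u) 0)).trans (H.norm_deriv2_le 0 (by simp))
  refine ContinuousLinearMap.opNorm_le_bound₂ _ (by positivity) fun w v => ?_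
  set y := P z + h z • e with hy
  set w' := P w + fderiv ℝ h z w • e with hw'
  have hw'n : ‖w'‖ ≤ 2 * ‖w‖ := by
    have h1 := norm_add_le (P w) (fderiv ℝ h z w • e)
    rw [norm_smul, H.norm_eq, mul_one, Real.norm_eq_abs] at h1
    have h2 := hD1 z hz w
    have h3 := mul_le_mul_of_nonneg_right hκm (norm_nonneg w)
    linarith [H.norm_le w]
  have hDu : Differentiable ℝ (fderiv ℝ u) := differentiable_fderiv H.contDiff
  have hcomp : HasFDerivAt (fun x => fderiv ℝ u (P x + h x • e))
      ((fderiv ℝ (fderiv ℝ u) y).comp (P + (fderiv ℝ h z).smulRight e)) z :=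
    (hDu y).hasFDerivAt.comp z (hY z hz)
  have happ : ∀ a : E, HasFDerivAt (fun x => fderiv ℝ u (P x + h x • e) a)
      ((ContinuousLinearMap.apply ℝ ℝ a).comp
        ((fderiv ℝ (fderiv ℝ u) y).comp (P + (fderiv ℝ h z).smulRight e))) z := fun a =>
    (ContinuousLinearMap.apply ℝ ℝ a).hasFDerivAt.comp z hcomp
  have hDh : HasFDerivAt (fun x => fderiv ℝ h x v)
      ((ContinuousLinearMap.apply ℝ ℝ v).comp (fderiv ℝ (fderiv ℝ h) z)) z :=
    (ContinuousLinearMap.apply ℝ ℝ v).hasFDerivAt.comp z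
      (((hC z hz).fderiv_right (m := 1) (by norm_num)).differentiableAt
        (by norm_num)).hasFDerivAt
  have hsum := (happ (P v)).add (hDh.mul (happ e))
  have hzero : HasFDerivAt (fun x => fderiv ℝ u (P x + h x • e) (P v) +
      fderiv ℝ h x v * fderiv ℝ u (P x + h x • e) e) (0 : E →L[ℝ] ℝ) z :=
    (hasFDerivAt_const (0 : ℝ) z).congr_of_eventuallyEq (by
      filter_upwards [isOpen_ball.mem_nhds hz] with x hx using hid x hx v)
  have h3 := congrArg (fun T : E →L[ℝ] ℝ => T w) (hsum.unique hzero)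
  have h4 : fderiv ℝ (fderiv ℝ u) y w' (P v) + (fderiv ℝ h z v * fderiv ℝ (fderiv ℝ u) y w' e +
      fderiv ℝ u y e * fderiv ℝ (fderiv ℝ h) z w v) = 0 := by
    simpa [hw', mul_add, ← hy] using h3
  have h5 := H.abs_deriv2_le y (hmem z hz) w' v
  have h6 : |fderiv ℝ (fderiv ℝ u) y w' e| ≤ M * ‖w'‖ := by
    have := (fderiv ℝ (fderiv ℝ u) y).le_opNorm₂ w' e
    rw [H.norm_eq, mul_one, Real.norm_eq_abs] at this
    exact this.trans (mul_le_mul_of_nonneg_right (H.norm_deriv2_le y (hmem z hz)) (norm_nonneg _))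
  have h7 := hD1 z hz v
  have h8 := H.le_deriv y (hmem z hz)
  have h9 : |fderiv ℝ (fderiv ℝ h) z w v| * m ≤ κ * ‖w'‖ * ‖v‖ + κ / m * ‖v‖ * (M * ‖w'‖) := by
    calc _ ≤ |fderiv ℝ (fderiv ℝ h) z w v| * fderiv ℝ u y e :=
          mul_le_mul_of_nonneg_left h8 (abs_nonneg _)
      _ = |fderiv ℝ u y e * fderiv ℝ (fderiv ℝ h) z w v| := by
          rw [abs_mul, abs_of_pos (hm.trans_le h8), mul_comm]
      _ = |fderiv ℝ (fderiv ℝ u) y w' (P v) +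
            fderiv ℝ h z v * fderiv ℝ (fderiv ℝ u) y w' e| := by
          rw [← abs_neg]; congr 1; linarith
      _ ≤ _ := by
          refine (abs_add_le _ _).trans (add_le_add h5 ?_)
          rw [abs_mul]
          exact mul_le_mul h7 h6 (abs_nonneg _) (by positivity)
  have h10 : κ * ‖w'‖ * ‖v‖ + κ / m * ‖v‖ * (M * ‖w'‖) = κ * (1 + M / m) * ‖v‖ * ‖w'‖ := by
    ring
  have h11 : κ * (1 + M / m) * ‖v‖ * ‖w'‖ ≤ κ * (1 + M / m) * ‖v‖ * (2 * ‖w‖) :=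
    mul_le_mul_of_nonneg_left hw'n (by positivity)
  rw [Real.norm_eq_abs, div_mul_eq_mul_div, div_mul_eq_mul_div, le_div_iff₀ hm]
  linarith

end IsNearlyFlat

/-- Under the flatness hypotheses the level set is locally the graph of a globally defined
function with small second derivative. -/
lemma exists_contDiff_graph (E : Type*) [NormedAddCommGroup E] [InnerProductSpace ℝ E]
    [FiniteDimensional ℝ E] {m M : ℝ} (hm : 0 < m) (hM : 0 ≤ M) :
    ∃ A > 0, ∀ (u : E → ℝ) (P : E →L[ℝ] E) (e : E) (κ : ℝ), IsNearlyFlat u P e m M κ →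
      ∃ h : E → ℝ, ContDiff ℝ 2 h ∧ (∀ z, ‖iteratedFDeriv ℝ 2 h z‖ ≤ A * κ) ∧
        ∀ z ∈ ball (0 : E) 2, ∀ t ∈ Icc (-2 : ℝ) 2, u (P z + t • e) = 0 ↔ t = h z := by
  have : CompleteSpace E := FiniteDimensional.complete ℝ E
  let η : ContDiffBump (0 : E) := ⟨2, 3, by norm_num, by norm_num⟩
  have hη : ContDiff ℝ 2 η := η.contDiff (n := 2)
  have hB : ∀ i : ℕ, i ≤ 2 → ∃ B, ∀ x, ‖iteratedFDeriv ℝ i η x‖ ≤ B := fun i hi =>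
    (η.hasCompactSupport.iteratedFDeriv i).exists_bound_of_continuous
      (hη.continuous_iteratedFDeriv (by exact_mod_cast hi))
  obtain ⟨B0, hB0⟩ := hB 0 (by norm_num)
  obtain ⟨B1, hB1⟩ := hB 1 (by norm_num)
  obtain ⟨B2, hB2⟩ := hB 2 (by norm_num)
  have hB0' : 0 ≤ B0 := (norm_nonneg _).trans (hB0 0)
  have hB1' : 0 ≤ B1 := (norm_nonneg _).trans (hB1 0)
  have hB2' : 0 ≤ B2 := (norm_nonneg _).trans (hB2 0)
  refine ⟨B0 * (2 * (1 + M / m) / m) + 2 * B1 * m⁻¹ + B2 * m⁻¹ + 1, by positivity, ?_⟩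
  intro u P e κ H
  have hκ := H.nonneg
  obtain ⟨h, hh⟩ := H.exists_graph
  have hC : ContDiffOn ℝ 2 h (ball 0 5) := fun z hz =>
    (H.contDiffAt_graph hh hz).contDiffWithinAt
  have hzero : ∀ z ∉ closedBall (0 : E) 3, (fun z => η z * h z) =ᶠ[nhds z] fun _ => 0 := by
    intro z hz
    filter_upwards [isClosed_closedBall.isOpen_compl.mem_nhds hz] with y hy
    have : η y = 0 := by
      by_contra hne
      exact hy (η.tsupport_eq ▸ subset_tsupport _ hne)
    rw [this, zero_mul]
  refine ⟨fun z => η z * h z, ?_, ?_, ?_⟩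
  · refine contDiff_iff_contDiffAt.2 fun z => ?_
    by_cases hz : z ∈ closedBall (0 : E) 3
    · exact hη.contDiffAt.mul (H.contDiffAt_graph hh (closedBall_subset_ball (by norm_num) hz))
    · exact contDiffAt_const.congr_of_eventuallyEq (hzero z hz)
  · intro z
    by_cases hz : z ∈ closedBall (0 : E) 3
    · have hz5 : z ∈ ball (0 : E) 5 := closedBall_subset_ball (by norm_num) hz
      have h1 := norm_iteratedFDerivWithin_mul_le hη.contDiffOn hC isOpen_ball.uniqueDiffOn hz5
        (n := 2) le_rfl
      simp only [iteratedFDerivWithin_of_isOpen _ isOpen_ball hz5, Finset.sum_range_succ,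
        Finset.sum_range_zero] at h1
      replace h1 : ‖iteratedFDeriv ℝ 2 (fun y => η y * h y) z‖ ≤
          0 + (Nat.choose 2 0 : ℕ) * ‖iteratedFDeriv ℝ 0 η z‖ * ‖iteratedFDeriv ℝ 2 h z‖ +
          (Nat.choose 2 1 : ℕ) * ‖iteratedFDeriv ℝ 1 η z‖ * ‖iteratedFDeriv ℝ 1 h z‖ +
          (Nat.choose 2 2 : ℕ) * ‖iteratedFDeriv ℝ 2 η z‖ * ‖iteratedFDeriv ℝ 0 h z‖ := h1
      obtain ⟨h2, h3⟩ := H.abs_deriv_graph_le hh hz5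
      have h4 : ‖iteratedFDeriv ℝ 0 h z‖ ≤ κ / m := by
        rw [norm_iteratedFDeriv_zero]; exact (hh z hz5).1
      rw [← norm_iteratedFDeriv_one] at h2
      rw [← norm_iteratedFDeriv_one, norm_iteratedFDeriv_fderiv] at h3
      have h5 := mul_le_mul (hB0 z) h3 (norm_nonneg _) hB0'
      have h6 := mul_le_mul (hB1 z) h2 (norm_nonneg _) hB1'
      have h7 := mul_le_mul (hB2 z) h4 (norm_nonneg _) hB2'
      norm_num only [Nat.choose, Nat.cast_one, Nat.cast_ofNat, one_mul, zero_add] at h1 h5 h6 h7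
      refine h1.trans ?_
      have e1 : (B0 * (2 * (1 + M / m) / m) + 2 * B1 * m⁻¹ + B2 * m⁻¹ + 1) * κ =
        B0 * (2 * κ * (1 + M / m) / m) + 2 * (B1 * (κ / m)) + B2 * (κ / m) + κ := by ring
      rw [e1]
      linarith
    · rw [(hzero z hz).iteratedFDeriv ℝ 2 |>.eq_of_nhds]
      rw [iteratedFDeriv_const_of_ne two_ne_zero]
      simp only [Pi.zero_apply, norm_zero]
      positivity
  · intro z hz t ht
    have hz5 : z ∈ ball (0 : E) 5 := ball_subset_ball (by norm_num) hz
    have h1 : η z = 1 := η.one_of_mem_closedBall (ball_subset_closedBall hz)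
    simp only [h1, one_mul]
    obtain ⟨-, h2, h3⟩ := hh z hz5
    exact ⟨h3 t ht, fun h => h ▸ h2⟩

end Graph

/-! ### Flatness of solutions close to the one-dimensional profile -/

section Flat

variable {n : ℕ} {f V g g1 : ℝ → ℝ} {L : ℝ}

lemma abs_apply_le_of_abs_single_le (T : EuclideanSpace ℝ (Fin n) →L[ℝ] ℝ) {κ : ℝ}
    (hκ : 0 ≤ κ) (v : EuclideanSpace ℝ (Fin n))
    (hT : ∀ j, v j ≠ 0 → |T (EuclideanSpace.single j 1)| ≤ κ) : |T v| ≤ n * κ * ‖v‖ := by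
  have h1 : v = ∑ j, v j • EuclideanSpace.single j (1:ℝ) := by
    ext k
    simp [Pi.single_apply]
  have h2 : T v = ∑ j, v j * T (EuclideanSpace.single j 1) := by
    conv_lhs => rw [h1]
    simp
  rw [h2]
  refine (Finset.abs_sum_le_sum_abs _ _).trans ?_
  have h3 : ∀ j ∈ Finset.univ, |v j * T (EuclideanSpace.single j 1)| ≤ κ * ‖v‖ := by
    intro j _
    rw [abs_mul]
    by_cases hj : v j = 0
    · rw [hj, abs_zero, zero_mul]
      positivity
    · rw [mul_comm]
      exact mul_le_mul (hT j hj) (abs_coord_le_norm v j) (abs_nonneg _) hκ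
  refine (Finset.sum_le_sum h3).trans ?_
  simp [mul_assoc]

/-- The projection onto the hyperplane orthogonal to the `i₀`-th coordinate direction. -/
def projHyperplane (i₀ : Fin n) : EuclideanSpace ℝ (Fin n) →L[ℝ] EuclideanSpace ℝ (Fin n) :=
  ContinuousLinearMap.id ℝ _ -
    (EuclideanSpace.proj i₀ : EuclideanSpace ℝ (Fin n) →L[ℝ] ℝ).smulRight
      (EuclideanSpace.single i₀ (1:ℝ))

lemma projHyperplane_apply (i₀ : Fin n) (x : EuclideanSpace ℝ (Fin n)) :
    projHyperplane i₀ x = x - x i₀ • EuclideanSpace.single i₀ (1:ℝ) := by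
  simp [projHyperplane]

lemma projHyperplane_apply_self (i₀ : Fin n) (x : EuclideanSpace ℝ (Fin n)) :
    projHyperplane i₀ x i₀ = 0 := by
  simp [projHyperplane_apply]

lemma norm_projHyperplane_le (i₀ : Fin n) (x : EuclideanSpace ℝ (Fin n)) :
    ‖projHyperplane i₀ x‖ ≤ ‖x‖ := by
  have h := norm_add_smul_single_sq (projHyperplane i₀ x) i₀ (x i₀)
  rw [projHyperplane_apply_self, projHyperplane_apply, sub_add_cancel] at h
  rw [projHyperplane_apply]
  refine abs_le_of_sq_le_sq' ?_ (norm_nonneg _) |>.2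
  nlinarith [sq_nonneg (x i₀)]

lemma exists_isNearlyFlat (hf : IsBistable f V L) (hg : IsProfile f g g1) (i₀ : Fin n) {C : ℝ}
    (hC : 0 < C) :
    ∃ m > 0, ∃ M ≥ 0, ∃ K > 0, ∃ R₀ > 0, ∀ R ≥ R₀, ∀ u : EuclideanSpace ℝ (Fin n) → ℝ,
      ContDiff ℝ 2 u → (∀ x, lap n u x = f (u x)) →
      (∀ x ∈ ball (0 : EuclideanSpace ℝ (Fin n)) 16, |u x - g (x i₀)| ≤ C / R) →
      IsNearlyFlat u (projHyperplane i₀) (EuclideanSpace.single i₀ 1) m M (K / R) := by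
  have hL := hf.pos
  obtain ⟨-, Λ, -, -, hΛ, -, -, -, -, hg1⟩ := hg.exists_bounds hf
  obtain ⟨t₀, -, ht₀⟩ := isCompact_Icc.exists_isMinOn (s := Icc (-8 : ℝ) 8)
    ⟨0, by norm_num, by norm_num⟩ (hg.continuous_deriv.continuousOn)
  set m := g1 t₀ / 2 with hm
  have hmp : 0 < m := half_pos (hg.deriv_pos t₀)
  set C₃ := (n + L) * C with hC₃
  set C₄ := (n + L) * C₃ with hC₄
  have hC₃p : 0 < C₃ := by positivity
  have hC₄p : 0 < C₄ := by positivity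
  set K := C + n * C₃ + n * (n * C₄) with hK
  have hKp : 0 < K := by positivity
  set M := (n + L) * (Λ + C₃) + C₄ with hM
  refine ⟨m, hmp, n * (n * M), by positivity, K, hKp, 1 + (C₃ + K) / m, by positivity, ?_⟩
  intro R hR u hu hlap hclose
  have hKm : 0 < (C₃ + K) / m := by positivity
  have hR1 : 1 ≤ R := by linarith
  have hR0 : 0 < R := by linarith
  have hRm : (C₃ + K) / R ≤ m := by
    rw [div_le_iff₀ hR0]
    rw [ge_iff_le, ← sub_nonneg] at hR
    have h1 : (C₃ + K) / m ≤ R := by linarith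
    rw [div_le_iff₀ hmp] at h1
    linarith
  have hRsplit : (C₃ + K) / R = C₃ / R + K / R := add_div _ _ _
  have hC₃R : 0 < C₃ / R := by positivity
  have hKR : 0 < K / R := by positivity
  have hG := hg.contDiff_comp_coord hf i₀
  have hz : ContDiff ℝ 2 fun x : EuclideanSpace ℝ (Fin n) => u x - g (x i₀) := hu.sub hG
  have hfirst : ∀ x ∈ closedBall (0 : EuclideanSpace ℝ (Fin n)) 13, ∀ i,
      |fderiv ℝ u x (EuclideanSpace.single i 1) - if i₀ = i then g1 (x i₀) else 0| ≤ C₃ / R := by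
    intro x hx i
    have hsub : ∀ y ∈ closedBall x 2, y ∈ ball (0 : EuclideanSpace ℝ (Fin n)) 16 := by
      intro y hy
      rw [mem_closedBall] at hx hy
      rw [mem_ball]
      linarith [dist_triangle y x 0]
    have h1 := abs_partial_deriv_le_of_bounds hz i (M := C / R) (N := 2 * (L * (C / R)))
      (x₀ := x) (fun y hy => hclose y (hsub y hy)) (fun y hy => by
        rw [lap_sub hu hG, hlap, hg.lap_comp_coord hf]
        have h2 := hf.abs_sub_le (u y) (g (y i₀))
        have h3 := mul_le_mul_of_nonneg_left (hclose y (hsub y hy)) hL.le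
        have h4 : 0 < L * (C / R) := by positivity
        linarith)
    rw [fderiv_fun_sub (hu.differentiable (by norm_num) x) (hG.differentiable (by norm_num) x),
      sub_apply, hg.fderiv_comp_coord hf] at h1
    refine h1.trans (le_of_eq ?_)
    rw [hC₃]
    ring
  have hsmall : ∀ x ∈ closedBall (0 : EuclideanSpace ℝ (Fin n)) 13, ∀ i, i ≠ i₀ →
      |fderiv ℝ u x (EuclideanSpace.single i 1)| ≤ C₃ / R := by
    intro x hx i hi
    simpa [hi.symm] using hfirst x hx i
  have hball : ∀ x ∈ ball (0 : EuclideanSpace ℝ (Fin n)) 8, ∀ y ∈ closedBall x 3,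
      y ∈ closedBall (0 : EuclideanSpace ℝ (Fin n)) 13 := by
    intro x hx y hy
    rw [mem_ball] at hx
    rw [mem_closedBall] at hy ⊢
    linarith [dist_triangle y x 0]
  have hsecond : ∀ x ∈ ball (0 : EuclideanSpace ℝ (Fin n)) 8, ∀ i j, i ≠ i₀ →
      |fderiv ℝ (fderiv ℝ u) x (EuclideanSpace.single i 1) (EuclideanSpace.single j 1)| ≤
        C₄ / R := by
    intro x hx i j hi
    refine (abs_fderiv_fderiv_le hf hu hlap i j hC₃R
      fun y hy => hsmall y (hball x hx y hy) i hi).trans (le_of_eq ?_)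
    rw [hC₄]
    ring
  have hsymm : ∀ x, IsSymmSndFDerivAt ℝ u x := fun x =>
    hu.contDiffAt.isSymmSndFDerivAt (by simp)
  have hbound : ∀ x ∈ ball (0 : EuclideanSpace ℝ (Fin n)) 8, ∀ i j,
      |fderiv ℝ (fderiv ℝ u) x (EuclideanSpace.single i 1) (EuclideanSpace.single j 1)| ≤ M := by
    intro x hx i j
    by_cases hi : i = i₀
    · have h0 : 0 < Λ + C₃ := by positivity
      refine (abs_fderiv_fderiv_le hf hu hlap i j h0 fun y hy => ?_).trans
        (by rw [hM]; linarith)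
      have h1 := abs_le.1 (hfirst y (hball x hx y hy) i)
      rw [if_pos hi.symm] at h1
      have h2 := hg1 (y i₀)
      have h3 := hg.deriv_pos (y i₀)
      have h4 : C₃ / R ≤ C₃ := div_le_self hC₃p.le hR1
      rw [abs_le]
      constructor <;> linarith
    · refine (hsecond x hx i j hi).trans ((div_le_self hC₄p.le hR1).trans ?_)
      rw [hM]
      have : 0 < (n + L) * (Λ + C₃) := by positivity
      linarith
  have hKdiv : K / R = C / R + n * (C₃ / R) + n * (n * (C₄ / R)) := by rw [hK]; ring
  have hCR : 0 < C / R := by positivity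
  have hn3 : 0 ≤ n * (C₃ / R) := by positivity
  have hn4 : 0 ≤ n * (n * (C₄ / R)) := by positivity
  have hself : ∀ (v : EuclideanSpace ℝ (Fin n)) j, projHyperplane i₀ v j ≠ 0 → j ≠ i₀ :=
    fun v j hj h => hj (h ▸ projHyperplane_apply_self i₀ v)
  refine ⟨hu, norm_projHyperplane_le i₀, by simp, hmp, by linarith, ?_, ?_, ?_, ?_, ?_⟩
  · intro x hx
    have h1 := abs_le.1 (hfirst x (hball x hx x (mem_closedBall_self (by norm_num))) i₀)
    rw [if_pos rfl] at h1
    rw [mem_ball_zero_iff] at hx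
    have h2 := abs_le.1 ((abs_coord_le_norm x i₀).trans hx.le)
    have h3 : g1 t₀ ≤ g1 (x i₀) := ht₀ h2
    linarith
  · intro z hz
    have h1 := hclose (projHyperplane i₀ z) (by
      rw [mem_ball_zero_iff] at hz ⊢
      linarith [norm_projHyperplane_le i₀ z])
    rw [projHyperplane_apply_self, hg.zero, sub_zero] at h1
    linarith
  · intro x hx v
    refine (abs_apply_le_of_abs_single_le _ hC₃R.le _ fun j hj =>
      hsmall x (hball x hx x (mem_closedBall_self (by norm_num))) j (hself v j hj)).trans ?_
    exact mul_le_mul (by linarith) (norm_projHyperplane_le i₀ v) (norm_nonneg _) hKR.le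
  · intro x hx w v
    refine (abs_apply_le_of_abs_single_le (κ := n * (C₄ / R) * ‖w‖) _ (by positivity) _
      fun j hj => ?_).trans
      (?_ : _ ≤ n * (n * (C₄ / R) * ‖w‖) * ‖v‖) |>.trans ?_
    · rw [(hsymm x).eq]
      exact abs_apply_le_of_abs_single_le _ (by positivity) w
        fun i _ => hsecond x hx j i (hself v j hj)
    · exact mul_le_mul_of_nonneg_left (norm_projHyperplane_le i₀ v) (by positivity)
    · rw [← mul_assoc]
      gcongr
      linarith
  · intro x hx
    have hM0 : 0 ≤ M := by positivity
    refine ContinuousLinearMap.opNorm_le_bound₂ _ (by positivity) fun w v => ?_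
    rw [Real.norm_eq_abs]
    refine (abs_apply_le_of_abs_single_le (κ := n * M * ‖w‖) _ (by positivity) v
      fun j _ => ?_).trans (le_of_eq (by ring))
    rw [(hsymm x).eq]
    exact abs_apply_le_of_abs_single_le _ hM0 w fun i _ => hbound x hx j i

end Flat

/-- Lemma 2.4: if `B_R(-R eₙ) ⊂ {u<0}` is tangent to `{u=0}` at `0` and `u` is
close to `-1` somewhere in `B_{R/4}(-R eₙ)`, then in `B₁` the level set `{u=0}` is a `C²` graph
in the `eₙ` direction with second derivatives `≤ C/R` and `|u - g(xₙ)| ≤ C/R`. -/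
theorem estimates_tangent_ball
    (n : ℕ) (hn : 1 ≤ n) (i₀ : Fin n) (hi₀ : (i₀ : ℕ) = n - 1)
    (W : ℝ → ℝ) (hW : DoubleWell W)
    (g : ℝ → ℝ) (hg : IsOneDSolution W g) :
    ∃ c : ℝ, 0 < c ∧ ∃ C : ℝ, 0 < C ∧ ∃ R₀ : ℝ, ∀ R : ℝ, R₀ ≤ R →
      ∀ u : EuclideanSpace ℝ (Fin n) → ℝ,
        ContDiff ℝ 2 u → (∀ x, |u x| ≤ 1) →
        (∀ x, lap n u x = deriv W (u x)) →
        (∀ x ∈ Metric.ball (-(R • EuclideanSpace.single i₀ (1:ℝ))) R, u x < 0) →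
        u 0 = 0 →
      ∀ x₀ ∈ Metric.ball (-(R • EuclideanSpace.single i₀ (1:ℝ))) (R/4),
        u x₀ ≤ -1 + c →
        (∃ h : EuclideanSpace ℝ (Fin n) → ℝ, ContDiff ℝ 2 h ∧
          (∀ z, ‖iteratedFDeriv ℝ 2 h z‖ ≤ C / R) ∧
          (∀ x ∈ Metric.ball (0 : EuclideanSpace ℝ (Fin n)) 1,
            (u x = 0 ↔ x i₀ = h (x - x i₀ • EuclideanSpace.single i₀ (1:ℝ))))) ∧
        (∀ x ∈ Metric.ball (0 : EuclideanSpace ℝ (Fin n)) 1,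
          |u x - g (x i₀)| ≤ C / R) := by
  obtain ⟨f, V, L, hf, hfW⟩ := hW.exists_isBistable
  have hp : IsProfile f g (deriv g) :=
    hg.isProfile hfW
  obtain ⟨ε, hε, C, hC, R₁, hR₁, hclose⟩ := exists_abs_sub_le hf hp n i₀
  obtain ⟨m, hm, M, hM, K, hK, R₂, hR₂, hflat⟩ := exists_isNearlyFlat hf hp i₀ hC
  obtain ⟨A, hA, hgraph⟩ := exists_contDiff_graph (EuclideanSpace ℝ (Fin n)) hm hM
  refine ⟨ε, hε, C + A * K, by positivity, R₁ + R₂, ?_⟩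
  intro R hR u hu hu1 hlap hneg hu0 x₀ hx₀ hux₀
  have hlap' : ∀ x, lap n u x = f (u x) := fun x => by
    rw [hlap, hfW _ (abs_le.1 (hu1 x))]
  have hcl := hclose R (by linarith) u hu hu1 hlap' hneg hu0 x₀ hx₀ hux₀
  have hR0 : 0 < R := by linarith
  have e1 : (C + A * K) / R = C / R + A * (K / R) := by ring
  have hCR : 0 < C / R := by positivity
  have hKR : 0 < A * (K / R) := by positivity
  obtain ⟨h, hh, hh2, hh3⟩ := hgraph u _ _ _ (hflat R (by linarith) u hu hlap' hcl)
  refine ⟨⟨h, hh, fun z => (hh2 z).trans (by linarith), fun x hx => ?_⟩, fun x hx =>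
    (hcl x (ball_subset_ball (by norm_num) hx)).trans (by linarith)⟩
  rw [mem_ball_zero_iff] at hx
  have h1 := abs_le.1 ((abs_coord_le_norm x i₀).trans hx.le)
  have h2 := norm_projHyperplane_le i₀ x
  have h3 := hh3 (projHyperplane i₀ x) (by rw [mem_ball_zero_iff]; linarith) (x i₀)
    ⟨by linarith, by linarith⟩
  have h4 : projHyperplane i₀ (projHyperplane i₀ x) = projHyperplane i₀ x := by
    rw [projHyperplane_apply i₀ (projHyperplane i₀ x), projHyperplane_apply_self, zero_smul,
      sub_zero]
  rw [h4, projHyperplane_apply, sub_add_cancel] at h3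
  exact h3


end
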